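/- arXiv:1306.3191 — 2 statements merged into one kernel-verified Lean document; each statement's English description precedes it below -/
import Mathlib

section
/- Let C : H → H be μ-Lipschitz continuous for μ > 0 and suppose z ∈ ran(A + Σ_{i=1}^m L_i*((K_i* ∘ B_i ∘ K_i) □ (M_i* ∘ D_i ∘ M_i))(L_i · − r_i) + C). Then the sequences generated by Algorithm 3.4 satisfy Σ_{n≥0} ‖x_n − x̃_n‖² < +∞ and, for every i = 1,…,m, Σ_{n≥0} ‖p_{i,n} − p̃_{i,n}‖² < +∞, Σ_{n≥0} ‖q_{i,n} − q̃_{i,n}‖² < +∞ and Σ_{n≥0} ‖y_{i,n} − ỹ_{i,n}‖² < +∞. -/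
open scoped RealInnerProductSpace
open Filter Topology

noncomputable section

def MonoOp {E : Type*} [NormedAddCommGroup E] [InnerProductSpace ℝ E] (A : E → Set E) : Prop :=
  ∀ ⦃x y u v : E⦄, u ∈ A x → v ∈ A y → (0:ℝ) ≤ ⟪x - y, u - v⟫

def MaxMonoOp {E : Type*} [NormedAddCommGroup E] [InnerProductSpace ℝ E] (A : E → Set E) : Prop :=
  MonoOp A ∧ ∀ B : E → Set E, MonoOp B → (∀ x, A x ⊆ B x) → B = A

def invOp {E : Type*} (A : E → Set E) : E → Set E := fun u => {x | u ∈ A x}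

def sumOp {E : Type*} [Add E] (A B : E → Set E) : E → Set E :=
  fun x => {s | ∃ u ∈ A x, ∃ v ∈ B x, s = u + v}

/-- parallel sum `A □ B = (A⁻¹ + B⁻¹)⁻¹` -/
def parOp {E : Type*} [Add E] (A B : E → Set E) : E → Set E :=
  invOp (sumOp (invOp A) (invOp B))

/-- `T* ∘ B ∘ T` -/
def compOp {F G : Type*} [NormedAddCommGroup F] [InnerProductSpace ℝ F] [CompleteSpace F]
    [NormedAddCommGroup G] [InnerProductSpace ℝ G] [CompleteSpace G]
    (T : F →L[ℝ] G) (B : G → Set G) : F → Set F :=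
  fun x => (ContinuousLinearMap.adjoint T) '' (B (T x))

def smulOp {E : Type*} [SMul ℝ E] (γ : ℝ) (A : E → Set E) : E → Set E :=
  fun x => (γ • ·) '' A x

/-- `x = J_{γ A}(w)`, i.e. `w ∈ x + γ A x`. -/
def IsRes {E : Type*} [AddCommGroup E] [Module ℝ E] (γ : ℝ) (A : E → Set E) (w x : E) : Prop :=
  w - x ∈ smulOp γ A x

/-- weak convergence in a Hilbert space -/
def WConv {E : Type*} [NormedAddCommGroup E] [InnerProductSpace ℝ E] (u : ℕ → E) (l : E) : Prop :=
  ∀ w : E, Tendsto (fun n => ⟪u n, w⟫) atTop (𝓝 ⟪l, w⟫)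

section PrimalDualMethod

open WithLp

theorem norm_toLp_prod_le {E F : Type*} [NormedAddCommGroup E] [NormedAddCommGroup F]
    (a : E) (b : F) : ‖toLp 2 (a, b)‖ ≤ ‖a‖ + ‖b‖ := by
  refine le_of_sq_le_sq ?_ (by positivity)
  rw [prod_norm_sq_eq_of_L2]
  simp only [toLp_fst, toLp_snd]
  nlinarith [norm_nonneg a, norm_nonneg b, mul_nonneg (norm_nonneg a) (norm_nonneg b)]

theorem norm_toLp_pi_le {ι : Type*} [Fintype ι] {E : ι → Type*} [∀ i, NormedAddCommGroup (E i)]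
    (b : ∀ i, E i) : ‖(toLp 2 b : PiLp 2 E)‖ ≤ ∑ i, ‖b i‖ := by
  refine le_of_sq_le_sq ?_ (by positivity)
  rw [PiLp.norm_sq_eq_of_L2]
  exact Finset.sum_sq_le_sq_sum_of_nonneg fun i _ => norm_nonneg _

/-- A nonnegative sequence which decreases up to a summable error has summable decrements. -/
theorem summable_of_le_sub_add {a d e : ℕ → ℝ} (ha : ∀ n, 0 ≤ a n) (hd : ∀ n, 0 ≤ d n)
    (he : Summable e) (he0 : ∀ n, 0 ≤ e n) (h : ∀ n, d n ≤ a n - a (n + 1) + e n) :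
    Summable d := by
  refine summable_of_sum_range_le (c := a 0 + ∑' n, e n) hd fun n => ?_
  have h1 : ∑ i ∈ Finset.range n, d i ≤ a 0 - a n + ∑ i ∈ Finset.range n, e i := by
    rw [← Finset.sum_range_sub', ← Finset.sum_add_distrib]
    exact Finset.sum_le_sum fun i _ => h i
  linarith [ha n, he.sum_le_tsum (Finset.range n) fun i _ => he0 i]

/-- Summability of the residuals of the forward-backward-forward method with summable errors. -/
theorem summable_sq_norm_sub_of_forward_backward_forward {E : Type*} [NormedAddCommGroup E]
    [InnerProductSpace ℝ E] {Q : E → E} {β ε : ℝ} {γ : ℕ → ℝ} {w wt t : ℕ → E} {wbar : E}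
    (hQ : ∀ a b, ‖Q a - Q b‖ ≤ β * ‖a - b‖) (hε : ε ∈ Set.Ioo 0 1)
    (hγ0 : ∀ n, 0 ≤ γ n) (hγ : ∀ n, γ n * β ≤ 1 - ε)
    (hmono : ∀ n, 0 ≤ ⟪w n - t n - γ n • (Q (w n) - Q (t n)), t n - wbar⟫)
    (ht : Summable fun n => ‖wt n - t n‖)
    (hw : Summable fun n => ‖w (n + 1) - (wt n + γ n • (Q (w n) - Q (wt n)))‖) :
    Summable fun n => ‖w n - wt n‖ ^ 2 := by
  obtain ⟨hε0, hε1⟩ := hε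
  have hstep (n : ℕ) (a b : E) : ‖γ n • (Q a - Q b)‖ ≤ (1 - ε) * ‖a - b‖ := by
    rw [norm_smul, Real.norm_of_nonneg (hγ0 n)]
    calc γ n * ‖Q a - Q b‖ ≤ γ n * (β * ‖a - b‖) := by gcongr; exacts [hγ0 n, hQ a b]
      _ = γ n * β * ‖a - b‖ := by ring
      _ ≤ _ := by gcongr; exact hγ n
  set s : ℕ → E := fun n => t n + γ n • (Q (w n) - Q (t n)) with hs
  set e : ℕ → ℝ := fun n =>
    ‖w (n + 1) - (wt n + γ n • (Q (w n) - Q (wt n)))‖ + 2 * ‖wt n - t n‖ with he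
  have he_sum : Summable e := hw.add (ht.mul_left 2)
  have he0 (n) : 0 ≤ e n := by positivity
  have herr (n) : ‖w (n + 1) - s n‖ ≤ e n := by
    have h1 : w (n + 1) - s n = (w (n + 1) - (wt n + γ n • (Q (w n) - Q (wt n))))
        + (wt n - t n) - γ n • (Q (wt n) - Q (t n)) := by
      simp only [hs]; module
    rw [h1]
    have h2 := hstep n (wt n) (t n)
    have h3 := norm_sub_le ((w (n + 1) - (wt n + γ n • (Q (w n) - Q (wt n))))
        + (wt n - t n)) (γ n • (Q (wt n) - Q (t n)))
    have h4 := norm_add_le (w (n + 1) - (wt n + γ n • (Q (w n) - Q (wt n)))) (wt n - t n)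
    have h5 := mul_nonneg hε0.le (norm_nonneg (wt n - t n))
    simp only [he]
    linarith
  have hfejer (n) : ‖s n - wbar‖ ^ 2 + ε * ‖w n - t n‖ ^ 2 ≤ ‖w n - wbar‖ ^ 2 := by
    have h1 : w n - wbar = (w n - t n) + (t n - wbar) := by abel
    have h2 : s n - wbar = γ n • (Q (w n) - Q (t n)) + (t n - wbar) := by
      simp only [hs]; abel
    have h3 := hmono n
    have h4 : ‖γ n • (Q (w n) - Q (t n))‖ ^ 2 ≤ ((1 - ε) * ‖w n - t n‖) ^ 2 := by
      gcongr; exact hstep n _ _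
    rw [inner_sub_left] at h3
    rw [h1, h2, norm_add_sq_real, norm_add_sq_real]
    have h5 : 0 ≤ ε * (1 - ε) * ‖w n - t n‖ ^ 2 := by
      have := sub_pos.2 hε1
      positivity
    nlinarith
  have hle (n) : ‖s n - wbar‖ ≤ ‖w n - wbar‖ := by
    refine le_of_sq_le_sq ?_ (norm_nonneg _)
    have : 0 ≤ ε * ‖w n - t n‖ ^ 2 := by positivity
    linarith [hfejer n]
  have htri (n) : ‖w (n + 1) - wbar‖ ≤ ‖s n - wbar‖ + e n := by
    have := norm_add_le (w (n + 1) - s n) (s n - wbar)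
    rw [sub_add_sub_cancel] at this
    linarith [herr n]
  have hbdd (n) : ‖w n - wbar‖ ≤ ‖w 0 - wbar‖ + ∑' k, e k := by
    have h1 : ‖w n - wbar‖ ≤ ‖w 0 - wbar‖ + ∑ k ∈ Finset.range n, e k := by
      induction n with
      | zero => simp
      | succ k ih => rw [Finset.sum_range_succ]; linarith [htri k, hle k]
    linarith [he_sum.sum_le_tsum (Finset.range n) fun i _ => he0 i]
  set R := ‖w 0 - wbar‖ + ∑' k, e k
  have hT (n) : e n ≤ ∑' k, e k := he_sum.le_tsum n fun i _ => he0 i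
  have hres : Summable fun n => ε * ‖w n - t n‖ ^ 2 := by
    refine summable_of_le_sub_add (a := fun n => ‖w n - wbar‖ ^ 2)
      (e := fun n => (2 * R + ∑' k, e k) * e n) (fun n => by positivity) (fun n => by positivity)
      (he_sum.mul_left _) (fun n => ?_) fun n => ?_
    · have hR : 0 ≤ R := (norm_nonneg _).trans (hbdd 0)
      have hT0 : 0 ≤ ∑' k, e k := tsum_nonneg he0
      exact mul_nonneg (by positivity) (he0 n)
    · have h1 : ‖w (n + 1) - wbar‖ ^ 2 ≤ (‖s n - wbar‖ + e n) ^ 2 := by gcongr; exact htri n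
      have h2 : ‖s n - wbar‖ * e n ≤ R * e n :=
        mul_le_mul_of_nonneg_right ((hle n).trans (hbdd n)) (he0 n)
      have h3 : e n * e n ≤ (∑' k, e k) * e n := mul_le_mul_of_nonneg_right (hT n) (he0 n)
      nlinarith [hfejer n]
  have hres' : Summable fun n => ‖w n - t n‖ ^ 2 := by
    simpa [hε0.ne'] using hres.mul_left ε⁻¹
  have ht2 : Summable fun n => ‖wt n - t n‖ ^ 2 := by
    refine Summable.of_nonneg_of_le (fun n => by positivity) (fun n => ?_)
      (ht.mul_left (∑' k, ‖wt k - t k‖))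
    rw [sq]
    gcongr
    exact ht.le_tsum n fun i _ => norm_nonneg _
  refine Summable.of_nonneg_of_le (fun n => by positivity) (fun n => ?_)
    ((hres'.mul_left 2).add (ht2.mul_left 2))
  have h1 : w n - wt n = (w n - t n) - (wt n - t n) := by abel
  have h2 := norm_sub_le (w n - t n) (wt n - t n)
  rw [← h1] at h2
  nlinarith [norm_nonneg (w n - wt n), sq_nonneg (‖w n - t n‖ - ‖wt n - t n‖)]

/-- The Hilbert direct sum of the spaces of the dual variables `(p, q, z, y, v)`. -/
abbrev DualSpace (X Y G : Type*) := WithLp 2 (X × WithLp 2 (Y × WithLp 2 (G × WithLp 2 (G × G))))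

/-- The Hilbert direct sum of the spaces of the primal variable and of all dual variables. -/
abbrev PrimalDualSpace {m : ℕ} (H : Type*) (X Y G : Fin m → Type*) :=
  WithLp 2 (H × PiLp 2 fun i => DualSpace (X i) (Y i) (G i))

/-- The element `(p, q, z, y, v)` of `DualSpace X Y G`. -/
def dualMk {X Y G : Type*} (p : X) (q : Y) (z y v : G) : DualSpace X Y G :=
  toLp 2 (p, toLp 2 (q, toLp 2 (z, toLp 2 (y, v))))

/-- The element `(x, b)` of `PrimalDualSpace H X Y G`. -/
def primalDualMk {m : ℕ} {H : Type*} {X Y G : Fin m → Type*}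
    (x : H) (b : ∀ i, DualSpace (X i) (Y i) (G i)) : PrimalDualSpace H X Y G :=
  toLp 2 (x, toLp 2 b)

section DualMk

variable {X Y G : Type*} [NormedAddCommGroup X] [NormedAddCommGroup Y] [NormedAddCommGroup G]

theorem dualMk_add (p p' : X) (q q' : Y) (z z' y y' v v' : G) :
    dualMk p q z y v + dualMk p' q' z' y' v' =
      dualMk (p + p') (q + q') (z + z') (y + y') (v + v') := rfl

theorem dualMk_sub (p p' : X) (q q' : Y) (z z' y y' v v' : G) :
    dualMk p q z y v - dualMk p' q' z' y' v' =
      dualMk (p - p') (q - q') (z - z') (y - y') (v - v') := rfl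

theorem norm_dualMk_sq (p : X) (q : Y) (z y v : G) :
    ‖dualMk p q z y v‖ ^ 2 = ‖p‖ ^ 2 + ‖q‖ ^ 2 + ‖z‖ ^ 2 + ‖y‖ ^ 2 + ‖v‖ ^ 2 := by
  simp [dualMk, prod_norm_sq_eq_of_L2, add_assoc]

theorem norm_dualMk_le (p : X) (q : Y) (z y v : G) :
    ‖dualMk p q z y v‖ ≤ ‖p‖ + ‖q‖ + ‖z‖ + ‖y‖ + ‖v‖ := by
  have h1 := norm_toLp_prod_le y v
  have h2 := norm_toLp_prod_le z (toLp 2 (y, v))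
  have h3 := norm_toLp_prod_le q (toLp 2 (z, toLp 2 (y, v)))
  have h4 := norm_toLp_prod_le p (toLp 2 (q, toLp 2 (z, toLp 2 (y, v))))
  rw [dualMk]
  linarith

theorem summable_norm_dualMk {p : ℕ → X} {q : ℕ → Y} {z y v : ℕ → G}
    (hp : Summable fun n => ‖p n‖) (hq : Summable fun n => ‖q n‖) (hz : Summable fun n => ‖z n‖)
    (hy : Summable fun n => ‖y n‖) (hv : Summable fun n => ‖v n‖) :
    Summable fun n => ‖dualMk (p n) (q n) (z n) (y n) (v n)‖ :=
  Summable.of_nonneg_of_le (fun _ => norm_nonneg _) (fun _ => norm_dualMk_le _ _ _ _ _)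
    ((((hp.add hq).add hz).add hy).add hv)

theorem summable_sq_norm_of_dualMk {p : ℕ → X} {q : ℕ → Y} {z y v : ℕ → G}
    (h : Summable fun n => ‖dualMk (p n) (q n) (z n) (y n) (v n)‖ ^ 2) :
    (Summable fun n => ‖p n‖ ^ 2) ∧ (Summable fun n => ‖q n‖ ^ 2) ∧
      Summable fun n => ‖y n‖ ^ 2 := by
  simp only [norm_dualMk_sq] at h
  refine ⟨.of_nonneg_of_le (fun _ => by positivity) (fun n => ?_) h,
    .of_nonneg_of_le (fun _ => by positivity) (fun n => ?_) h,
    .of_nonneg_of_le (fun _ => by positivity) (fun n => ?_) h⟩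
  all_goals linarith [sq_nonneg ‖p n‖, sq_nonneg ‖q n‖, sq_nonneg ‖z n‖, sq_nonneg ‖y n‖,
    sq_nonneg ‖v n‖]

variable [InnerProductSpace ℝ X] [InnerProductSpace ℝ Y] [InnerProductSpace ℝ G]

theorem smul_dualMk (c : ℝ) (p : X) (q : Y) (z y v : G) :
    c • dualMk p q z y v = dualMk (c • p) (c • q) (c • z) (c • y) (c • v) := rfl

theorem inner_dualMk (p p' : X) (q q' : Y) (z z' y y' v v' : G) :
    ⟪dualMk p q z y v, dualMk p' q' z' y' v'⟫ =
      ⟪p, p'⟫ + ⟪q, q'⟫ + ⟪z, z'⟫ + ⟪y, y'⟫ + ⟪v, v'⟫ := by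
  simp [dualMk, prod_inner_apply, add_assoc]

end DualMk

theorem exists_eq_primalDualMk {m : ℕ} {H : Type*} {X Y G : Fin m → Type*}
    (w : PrimalDualSpace H X Y G) :
    ∃ (x : H) (p : ∀ i, X i) (q : ∀ i, Y i) (z y v : ∀ i, G i),
      w = primalDualMk x fun i => dualMk (p i) (q i) (z i) (y i) (v i) :=
  ⟨w.fst, fun i => (w.snd i).fst, fun i => (w.snd i).snd.fst, fun i => (w.snd i).snd.snd.fst,
    fun i => (w.snd i).snd.snd.snd.fst, fun i => (w.snd i).snd.snd.snd.snd, rfl⟩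

theorem norm_sq_apply_le {E F : Type*} [NormedAddCommGroup E] [NormedSpace ℝ E]
    [NormedAddCommGroup F] [NormedSpace ℝ F] {T : E →L[ℝ] F} {s : ℝ} (hT : ‖T‖ ^ 2 ≤ s)
    (x : E) : ‖T x‖ ^ 2 ≤ s * ‖x‖ ^ 2 := by
  calc ‖T x‖ ^ 2 ≤ (‖T‖ * ‖x‖) ^ 2 := by gcongr; exact T.le_opNorm x
    _ = ‖T‖ ^ 2 * ‖x‖ ^ 2 := mul_pow _ _ _
    _ ≤ _ := by gcongr

section PrimalDual

variable {m : ℕ} {H : Type*} [NormedAddCommGroup H] {X Y G : Fin m → Type*}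
  [∀ i, NormedAddCommGroup (X i)] [∀ i, NormedAddCommGroup (Y i)] [∀ i, NormedAddCommGroup (G i)]

theorem primalDualMk_add (x x' : H) (b b' : ∀ i, DualSpace (X i) (Y i) (G i)) :
    primalDualMk x b + primalDualMk x' b' = primalDualMk (x + x') fun i => b i + b' i := rfl

theorem primalDualMk_sub (x x' : H) (b b' : ∀ i, DualSpace (X i) (Y i) (G i)) :
    primalDualMk x b - primalDualMk x' b' = primalDualMk (x - x') fun i => b i - b' i := rfl

theorem norm_primalDualMk_sq (x : H) (b : ∀ i, DualSpace (X i) (Y i) (G i)) :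
    ‖primalDualMk x b‖ ^ 2 = ‖x‖ ^ 2 + ∑ i, ‖b i‖ ^ 2 := by
  rw [primalDualMk, prod_norm_sq_eq_of_L2, toLp_fst, toLp_snd, PiLp.norm_sq_eq_of_L2]

theorem norm_primalDualMk_le (x : H) (b : ∀ i, DualSpace (X i) (Y i) (G i)) :
    ‖primalDualMk x b‖ ≤ ‖x‖ + ∑ i, ‖b i‖ :=
  (norm_toLp_prod_le _ _).trans (add_le_add le_rfl (norm_toLp_pi_le b))

theorem summable_norm_primalDualMk {x : ℕ → H} {b : ℕ → ∀ i, DualSpace (X i) (Y i) (G i)}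
    (hx : Summable fun n => ‖x n‖) (hb : ∀ i, Summable fun n => ‖b n i‖) :
    Summable fun n => ‖primalDualMk (x n) (b n)‖ :=
  Summable.of_nonneg_of_le (fun _ => norm_nonneg _) (fun _ => norm_primalDualMk_le _ _)
    (hx.add (summable_sum fun i _ => hb i))

theorem summable_sq_norm_of_primalDualMk {x : ℕ → H} {b : ℕ → ∀ i, DualSpace (X i) (Y i) (G i)}
    (h : Summable fun n => ‖primalDualMk (x n) (b n)‖ ^ 2) :
    (Summable fun n => ‖x n‖ ^ 2) ∧ ∀ i, Summable fun n => ‖b n i‖ ^ 2 := by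
  simp only [norm_primalDualMk_sq] at h
  refine ⟨.of_nonneg_of_le (fun _ => by positivity) (fun n => ?_) h,
    fun i => .of_nonneg_of_le (fun _ => by positivity) (fun n => ?_) h⟩
  · exact le_add_of_nonneg_right (by positivity)
  · exact le_add_of_nonneg_of_le (by positivity) (Finset.single_le_sum
      (f := fun i => ‖b n i‖ ^ 2) (fun j _ => by positivity) (Finset.mem_univ i))

variable [InnerProductSpace ℝ H] [∀ i, InnerProductSpace ℝ (X i)]
  [∀ i, InnerProductSpace ℝ (Y i)] [∀ i, InnerProductSpace ℝ (G i)]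

theorem smul_primalDualMk (c : ℝ) (x : H) (b : ∀ i, DualSpace (X i) (Y i) (G i)) :
    c • primalDualMk x b = primalDualMk (c • x) fun i => c • b i := rfl

theorem inner_primalDualMk (x x' : H) (b b' : ∀ i, DualSpace (X i) (Y i) (G i)) :
    ⟪primalDualMk x b, primalDualMk x' b'⟫ = ⟪x, x'⟫ + ∑ i, ⟪b i, b' i⟫ := by
  rw [primalDualMk, primalDualMk, prod_inner_apply, PiLp.inner_apply]

variable [CompleteSpace H] [∀ i, CompleteSpace (X i)] [∀ i, CompleteSpace (Y i)]
  [∀ i, CompleteSpace (G i)]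

/-- The single-valued part `(x, p, q, z, y, v) ↦ (C x + ∑ L* v, -K z, -M y, K* p, M* q, -L x)` of
the primal-dual operator. -/
def primalDualOp (C : H → H) (L : ∀ i, H →L[ℝ] G i) (K : ∀ i, G i →L[ℝ] X i)
    (M : ∀ i, G i →L[ℝ] Y i) (w : PrimalDualSpace H X Y G) : PrimalDualSpace H X Y G :=
  primalDualMk (C w.fst + ∑ i, (L i).adjoint (w.snd i).snd.snd.snd.snd) fun i =>
    dualMk (-K i (w.snd i).snd.snd.fst) (-M i (w.snd i).snd.snd.snd.fst)
      ((K i).adjoint (w.snd i).fst) ((M i).adjoint (w.snd i).snd.fst) (-L i w.fst)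

variable (C : H → H) (L : ∀ i, H →L[ℝ] G i) (K : ∀ i, G i →L[ℝ] X i) (M : ∀ i, G i →L[ℝ] Y i)

theorem primalDualOp_mk (x : H) (p : ∀ i, X i) (q : ∀ i, Y i) (z y v : ∀ i, G i) :
    primalDualOp C L K M (primalDualMk x fun i => dualMk (p i) (q i) (z i) (y i) (v i)) =
      primalDualMk (C x + ∑ i, (L i).adjoint (v i)) fun i =>
        dualMk (-K i (z i)) (-M i (y i)) ((K i).adjoint (p i)) ((M i).adjoint (q i)) (-L i x) :=
  rfl

variable {L K M} in
theorem norm_primalDualOp_zero_le {s : ℝ} (hL : ∑ i, ‖L i‖ ^ 2 ≤ s) (hK : ∀ i, ‖K i‖ ^ 2 ≤ s)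
    (hM : ∀ i, ‖M i‖ ^ 2 ≤ s) (w : PrimalDualSpace H X Y G) :
    ‖primalDualOp 0 L K M w‖ ≤ Real.sqrt s * ‖w‖ := by
  have hs : 0 ≤ s := (Finset.sum_nonneg fun i _ => sq_nonneg ‖L i‖).trans hL
  refine le_of_sq_le_sq ?_ (by positivity)
  obtain ⟨x, p, q, z, y, v, rfl⟩ := exists_eq_primalDualMk w
  rw [mul_pow, Real.sq_sqrt hs, primalDualOp_mk, norm_primalDualMk_sq, norm_primalDualMk_sq]
  simp only [norm_dualMk_sq, norm_neg, Pi.zero_apply, zero_add, Finset.sum_add_distrib]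
  have hadj : ‖∑ i, (L i).adjoint (v i)‖ ^ 2 ≤ s * ∑ i, ‖v i‖ ^ 2 := by
    calc ‖∑ i, (L i).adjoint (v i)‖ ^ 2 ≤ (∑ i, ‖L i‖ * ‖v i‖) ^ 2 := by
          gcongr
          refine norm_sum_le_of_le _ fun i _ => ?_
          simpa using (L i).adjoint.le_opNorm (v i)
      _ ≤ (∑ i, ‖L i‖ ^ 2) * ∑ i, ‖v i‖ ^ 2 := Finset.sum_mul_sq_le_sq_mul_sq _ _ _
      _ ≤ _ := by gcongr
  have hLx : ∑ i, ‖L i x‖ ^ 2 ≤ s * ‖x‖ ^ 2 := by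
    calc ∑ i, ‖L i x‖ ^ 2 ≤ ∑ i, ‖L i‖ ^ 2 * ‖x‖ ^ 2 :=
          Finset.sum_le_sum fun i _ => norm_sq_apply_le le_rfl x
      _ = (∑ i, ‖L i‖ ^ 2) * ‖x‖ ^ 2 := (Finset.sum_mul ..).symm
      _ ≤ _ := by gcongr
  have hKz : ∑ i, ‖K i (z i)‖ ^ 2 ≤ s * ∑ i, ‖z i‖ ^ 2 := by
    rw [Finset.mul_sum]; exact Finset.sum_le_sum fun i _ => norm_sq_apply_le (hK i) _
  have hMy : ∑ i, ‖M i (y i)‖ ^ 2 ≤ s * ∑ i, ‖y i‖ ^ 2 := by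
    rw [Finset.mul_sum]; exact Finset.sum_le_sum fun i _ => norm_sq_apply_le (hM i) _
  have hKp : ∑ i, ‖(K i).adjoint (p i)‖ ^ 2 ≤ s * ∑ i, ‖p i‖ ^ 2 := by
    rw [Finset.mul_sum]
    exact Finset.sum_le_sum fun i _ => norm_sq_apply_le (by simpa using hK i) _
  have hMq : ∑ i, ‖(M i).adjoint (q i)‖ ^ 2 ≤ s * ∑ i, ‖q i‖ ^ 2 := by
    rw [Finset.mul_sum]
    exact Finset.sum_le_sum fun i _ => norm_sq_apply_le (by simpa using hM i) _
  linarith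

variable {C L K M} in
theorem norm_primalDualOp_sub_le {μ s : ℝ} (hμ : 0 ≤ μ)
    (hC : ∀ x y, ‖C x - C y‖ ≤ μ * ‖x - y‖) (hL : ∑ i, ‖L i‖ ^ 2 ≤ s)
    (hK : ∀ i, ‖K i‖ ^ 2 ≤ s) (hM : ∀ i, ‖M i‖ ^ 2 ≤ s) (w w' : PrimalDualSpace H X Y G) :
    ‖primalDualOp C L K M w - primalDualOp C L K M w'‖ ≤ (μ + Real.sqrt s) * ‖w - w'‖ := by
  obtain ⟨x, p, q, z, y, v, rfl⟩ := exists_eq_primalDualMk w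
  obtain ⟨x', p', q', z', y', v', rfl⟩ := exists_eq_primalDualMk w'
  set d := (primalDualMk x fun i => dualMk (p i) (q i) (z i) (y i) (v i)) -
    primalDualMk x' fun i => dualMk (p' i) (q' i) (z' i) (y' i) (v' i) with hd
  have hsplit : primalDualMk (C x - C x') (fun i => dualMk 0 0 0 0 0) +
      primalDualOp 0 L K M d =
      primalDualOp C L K M (primalDualMk x fun i => dualMk (p i) (q i) (z i) (y i) (v i)) -
      primalDualOp C L K M
        (primalDualMk x' fun i => dualMk (p' i) (q' i) (z' i) (y' i) (v' i)) := by
    simp only [hd, primalDualMk_sub, dualMk_sub, primalDualOp_mk, primalDualMk_add, dualMk_add,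
      map_sub, Finset.sum_sub_distrib, Pi.zero_apply, zero_add, neg_sub, neg_sub_neg,
      add_sub_add_comm]
  have hfst : ‖x - x'‖ ≤ ‖d‖ := by
    refine le_of_sq_le_sq ?_ (norm_nonneg _)
    rw [hd, primalDualMk_sub, norm_primalDualMk_sq]
    exact le_add_of_nonneg_right (by positivity)
  rw [← hsplit, add_mul]
  refine norm_add_le_of_le ((norm_primalDualMk_le _ _).trans ?_)
    (norm_primalDualOp_zero_le hL hK hM _)
  have h0 (i : Fin m) : ‖(dualMk 0 0 0 0 0 : DualSpace (X i) (Y i) (G i))‖ = 0 :=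
    norm_zero (E := DualSpace (X i) (Y i) (G i))
  simp only [h0, Finset.sum_const_zero, add_zero]
  exact (hC _ _).trans (by gcongr)

end PrimalDual

section Resolvent

variable {H X Y G : Type*} [NormedAddCommGroup H] [InnerProductSpace ℝ H]
  [NormedAddCommGroup X] [InnerProductSpace ℝ X] [NormedAddCommGroup Y] [InnerProductSpace ℝ Y]
  [NormedAddCommGroup G] [InnerProductSpace ℝ G]

theorem resolvent_pair_eq {a : ℝ} (ha : 0 ≤ a) {u₁ u₂ z y : G}
    (hz : z = ((1 + a) / (1 + 2 * a)) • (u₁ - (a / (1 + a)) • u₂))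
    (hy : y = (1 / (1 + a)) • (u₂ - a • z)) :
    z + a • (z + y) = u₁ ∧ y + a • (z + y) = u₂ := by
  have h1 : 1 + a ≠ 0 := by positivity
  have h2 : 1 + 2 * a ≠ 0 := by positivity
  subst hy hz
  constructor <;> (match_scalars <;> field_simp <;> ring)

variable [CompleteSpace X] [CompleteSpace Y] [CompleteSpace G]

theorem neg_inner_le_inner_dualMk {B : X → Set X} {D : Y → Set Y} (hB : MonoOp B) (hD : MonoOp D)
    {L : H →L[ℝ] G} {K : G →L[ℝ] X} {M : G →L[ℝ] Y} {γ : ℝ} (hγ : 0 ≤ γ) {r : G}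
    {x x' xbar : H} {p p' pbar : X} {q q' qbar : Y} {z y v z' y' v' zbar ybar : G}
    (hp : IsRes γ (invOp B) (p + γ • K z) p') (hq : IsRes γ (invOp D) (q + γ • M y) q')
    (hz : z' + γ ^ 2 • (z' + y') = z - γ • (K.adjoint p - v - γ • (L x - r)))
    (hy : y' + γ ^ 2 • (z' + y') = y - γ • (M.adjoint q - v - γ • (L x - r)))
    (hv : v' = v + γ • (L x - r - z' - y'))
    (hpbar : pbar ∈ B (K zbar)) (hqbar : qbar ∈ D (M ybar))
    (hKM : M.adjoint qbar = K.adjoint pbar) (hbar : L xbar - r = zbar + ybar) :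
    -(γ * ⟪v' - K.adjoint pbar, L (x' - xbar)⟫) ≤
      ⟪dualMk p q z y v - dualMk p' q' z' y' v' -
        γ • (dualMk (-K z) (-M y) (K.adjoint p) (M.adjoint q) (-L x) -
          dualMk (-K z') (-M y') (K.adjoint p') (M.adjoint q') (-L x')),
        dualMk p' q' z' y' v' - dualMk pbar qbar zbar ybar (K.adjoint pbar)⟫ := by
  obtain ⟨b, hb, hpb : γ • b = _⟩ := hp
  obtain ⟨d, hd, hqd : γ • d = _⟩ := hq
  have hbmono := hB hb hpbar
  have hdmono := hD hd hqbar
  have e1 : p - p' - γ • (-K z - -K z') = γ • ((b - K zbar) - K (z' - zbar)) := by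
    have : p = γ • b + p' - γ • K z := by rw [hpb]; abel
    rw [this, map_sub]; module
  have e2 : q - q' - γ • (-M y - -M y') = γ • ((d - M ybar) - M (y' - ybar)) := by
    have : q = γ • d + q' - γ • M y := by rw [hqd]; abel
    rw [this, map_sub]; module
  have e3 : z - z' - γ • (K.adjoint p - K.adjoint p') =
      γ • (K.adjoint (p' - pbar) - (v' - K.adjoint pbar)) := by
    have : z = z' + γ ^ 2 • (z' + y') + γ • (K.adjoint p - v - γ • (L x - r)) := by rw [hz]; abel
    rw [this, hv, map_sub]; module
  have e4 : y - y' - γ • (M.adjoint q - M.adjoint q') =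
      γ • (M.adjoint (q' - qbar) - (v' - K.adjoint pbar)) := by
    have : y = y' + γ ^ 2 • (z' + y') + γ • (M.adjoint q - v - γ • (L x - r)) := by rw [hy]; abel
    rw [this, hv, map_sub, hKM]; module
  have e5 : v - v' - γ • (-L x - -L x') =
      γ • ((z' - zbar) + (y' - ybar) - L (x' - xbar)) := by
    have : r = L xbar - (zbar + ybar) := by rw [← hbar]; abel
    rw [hv, this, map_sub]; module
  simp only [dualMk_sub, smul_dualMk, inner_dualMk, e1, e2, e3, e4, e5, real_inner_smul_left]
  rw [inner_sub_left (b - K zbar), inner_sub_left (d - M ybar), inner_sub_left (K.adjoint _),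
    inner_sub_left (M.adjoint _), inner_sub_left (_ + _), inner_add_left,
    ContinuousLinearMap.adjoint_inner_left, ContinuousLinearMap.adjoint_inner_left,
    real_inner_comm (p' - pbar) (K _), real_inner_comm (q' - qbar) (M _),
    real_inner_comm (v' - K.adjoint pbar) (z' - zbar),
    real_inner_comm (v' - K.adjoint pbar) (y' - ybar),
    real_inner_comm (v' - K.adjoint pbar) (L _)]
  nlinarith [mul_nonneg hγ hbmono, mul_nonneg hγ hdmono]

end Resolvent

/-- Errors in the right-hand sides of the system solved by `resolvent_pair_eq` and in the
evaluation of its solution yield summable deviations from the exact solution. -/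
theorem summable_norm_sub_resolvent_pair {G : Type*} [NormedAddCommGroup G] [NormedSpace ℝ G]
    {a : ℕ → ℝ} (ha : ∀ n, 0 ≤ a n) {u₁ u₂ U₁ U₂ z y Z Y : ℕ → G}
    (hu₁ : Summable fun n => ‖u₁ n - U₁ n‖) (hu₂ : Summable fun n => ‖u₂ n - U₂ n‖)
    (hZ : ∀ n, Z n = ((1 + a n) / (1 + 2 * a n)) • (U₁ n - (a n / (1 + a n)) • U₂ n))
    (hY : ∀ n, Y n = (1 / (1 + a n)) • (U₂ n - a n • Z n))
    (hz : Summable fun n =>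
      ‖z n - ((1 + a n) / (1 + 2 * a n)) • (u₁ n - (a n / (1 + a n)) • u₂ n)‖)
    (hy : Summable fun n => ‖y n - (1 / (1 + a n)) • (u₂ n - a n • z n)‖) :
    (Summable fun n => ‖z n - Z n‖) ∧ Summable fun n => ‖y n - Y n‖ := by
  have hle {c : ℝ} (h0 : 0 ≤ c) (h1 : c ≤ 1) (w : G) : ‖c • w‖ ≤ ‖w‖ := by
    rw [norm_smul, Real.norm_of_nonneg h0]
    exact mul_le_of_le_one_left (norm_nonneg _) h1
  have h1 : Summable fun n => ‖z n - Z n‖ := by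
    refine Summable.of_nonneg_of_le (fun _ => norm_nonneg _) (fun n => ?_) (hz.add (hu₁.add hu₂))
    have ha := ha n
    have e : z n - Z n =
        (z n - ((1 + a n) / (1 + 2 * a n)) • (u₁ n - (a n / (1 + a n)) • u₂ n)) +
        ((1 + a n) / (1 + 2 * a n)) • ((u₁ n - U₁ n) - (a n / (1 + a n)) • (u₂ n - U₂ n)) := by
      rw [hZ]; module
    rw [e]
    refine norm_add_le_of_le le_rfl ((hle (by positivity) ?_ _).trans
      (norm_sub_le_of_le le_rfl (hle (by positivity) ?_ _)))
    · rw [div_le_one (by positivity)]; linarith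
    · rw [div_le_one (by positivity)]; linarith
  refine ⟨h1, Summable.of_nonneg_of_le (fun _ => norm_nonneg _) (fun n => ?_)
    (hy.add (hu₂.add h1))⟩
  have ha := ha n
  have e : y n - Y n = (y n - (1 / (1 + a n)) • (u₂ n - a n • z n)) +
      ((1 / (1 + a n)) • (u₂ n - U₂ n) - (a n / (1 + a n)) • (z n - Z n)) := by
    rw [hY, div_eq_mul_inv (a n), div_eq_mul_inv]; module
  rw [e]
  refine norm_add_le_of_le le_rfl (norm_sub_le_of_le (hle (by positivity) ?_ _)
    (hle (by positivity) ?_ _))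
  · rw [div_le_one (by positivity)]; linarith
  · rw [div_le_one (by positivity)]; linarith

theorem inner_primalDualOp_nonneg {m : ℕ} {H : Type*} {X Y G : Fin m → Type*}
    [NormedAddCommGroup H] [InnerProductSpace ℝ H] [CompleteSpace H]
    [∀ i, NormedAddCommGroup (X i)] [∀ i, InnerProductSpace ℝ (X i)] [∀ i, CompleteSpace (X i)]
    [∀ i, NormedAddCommGroup (Y i)] [∀ i, InnerProductSpace ℝ (Y i)] [∀ i, CompleteSpace (Y i)]
    [∀ i, NormedAddCommGroup (G i)] [∀ i, InnerProductSpace ℝ (G i)] [∀ i, CompleteSpace (G i)]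
    {A : H → Set H} {B : ∀ i, X i → Set (X i)} {D : ∀ i, Y i → Set (Y i)} {C : H → H}
    (hA : MonoOp A) (hB : ∀ i, MonoOp (B i)) (hD : ∀ i, MonoOp (D i))
    (hC : ∀ x y : H, (0 : ℝ) ≤ ⟪x - y, C x - C y⟫)
    {L : ∀ i, H →L[ℝ] G i} {K : ∀ i, G i →L[ℝ] X i} {M : ∀ i, G i →L[ℝ] Y i}
    {γ : ℝ} (hγ : 0 ≤ γ) {r : ∀ i, G i} {x₀ x x' xbar : H} {p p' pbar : ∀ i, X i}
    {q q' qbar : ∀ i, Y i} {z y v z' y' v' zbar ybar : ∀ i, G i}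
    (hx : IsRes γ A (x - γ • (C x + ∑ i, (L i).adjoint (v i) - x₀)) x')
    (hp : ∀ i, IsRes γ (invOp (B i)) (p i + γ • K i (z i)) (p' i))
    (hq : ∀ i, IsRes γ (invOp (D i)) (q i + γ • M i (y i)) (q' i))
    (hz : ∀ i, z' i + γ ^ 2 • (z' i + y' i) =
      z i - γ • ((K i).adjoint (p i) - v i - γ • (L i x - r i)))
    (hy : ∀ i, y' i + γ ^ 2 • (z' i + y' i) =
      y i - γ • ((M i).adjoint (q i) - v i - γ • (L i x - r i)))
    (hv : ∀ i, v' i = v i + γ • (L i x - r i - z' i - y' i))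
    (hxbar : x₀ - ∑ i, (L i).adjoint ((K i).adjoint (pbar i)) - C xbar ∈ A xbar)
    (hpbar : ∀ i, pbar i ∈ B i (K i (zbar i))) (hqbar : ∀ i, qbar i ∈ D i (M i (ybar i)))
    (hKM : ∀ i, (M i).adjoint (qbar i) = (K i).adjoint (pbar i))
    (hbar : ∀ i, L i xbar - r i = zbar i + ybar i) :
    0 ≤ ⟪(primalDualMk x fun i => dualMk (p i) (q i) (z i) (y i) (v i)) -
        (primalDualMk x' fun i => dualMk (p' i) (q' i) (z' i) (y' i) (v' i)) -
        γ • (primalDualOp C L K M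
            (primalDualMk x fun i => dualMk (p i) (q i) (z i) (y i) (v i)) -
          primalDualOp C L K M
            (primalDualMk x' fun i => dualMk (p' i) (q' i) (z' i) (y' i) (v' i))),
        (primalDualMk x' fun i => dualMk (p' i) (q' i) (z' i) (y' i) (v' i)) -
        primalDualMk xbar fun i =>
          dualMk (pbar i) (qbar i) (zbar i) (ybar i) ((K i).adjoint (pbar i))⟫ := by
  obtain ⟨a, ha, hxa : γ • a = _⟩ := hx
  have hsum := Finset.sum_le_sum fun i (_ : i ∈ Finset.univ) =>
    neg_inner_le_inner_dualMk (hB i) (hD i) (L := L i) (x' := x') hγ (hp i) (hq i) (hz i) (hy i)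
      (hv i) (hpbar i) (hqbar i) (hKM i) (hbar i)
  have e : x - x' - γ • (C x + ∑ i, (L i).adjoint (v i) - (C x' + ∑ i, (L i).adjoint (v' i))) =
      γ • ((a - (x₀ - ∑ i, (L i).adjoint ((K i).adjoint (pbar i)) - C xbar)) + (C x' - C xbar) +
        ∑ i, (L i).adjoint (v' i - (K i).adjoint (pbar i))) := by
    simp only [map_sub, Finset.sum_sub_distrib]
    have hx' : x = γ • a + x' + γ • (C x + ∑ i, (L i).adjoint (v i) - x₀) := by rw [hxa]; abel
    nth_rewrite 1 [hx']
    module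
  have hA' := hA ha hxbar
  have hC' := hC x' xbar
  simp only [primalDualOp_mk, primalDualMk_sub, smul_primalDualMk, inner_primalDualMk]
  rw [e, real_inner_smul_left, inner_add_left, inner_add_left, sum_inner]
  simp only [ContinuousLinearMap.adjoint_inner_left]
  rw [Finset.sum_neg_distrib, ← Finset.mul_sum] at hsum
  rw [real_inner_comm] at hA' hC'
  have := mul_nonneg hγ (add_nonneg hA' hC')
  linarith

end PrimalDualMethod

set_option maxHeartbeats 1000000 in
theorem stmt2 {m : ℕ}
    {H : Type*} [NormedAddCommGroup H] [InnerProductSpace ℝ H] [CompleteSpace H]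
    {G : Fin m → Type*} [∀ i, NormedAddCommGroup (G i)] [∀ i, InnerProductSpace ℝ (G i)]
    [∀ i, CompleteSpace (G i)]
    {X : Fin m → Type*} [∀ i, NormedAddCommGroup (X i)] [∀ i, InnerProductSpace ℝ (X i)]
    [∀ i, CompleteSpace (X i)]
    {Y : Fin m → Type*} [∀ i, NormedAddCommGroup (Y i)] [∀ i, InnerProductSpace ℝ (Y i)]
    [∀ i, CompleteSpace (Y i)]
    (z : H) (A : H → Set H) (hA : MaxMonoOp A)
    (μ : ℝ) (hμ : 0 < μ) (C : H → H)
    (hCmono : ∀ x y : H, (0:ℝ) ≤ ⟪x - y, C x - C y⟫)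
    (r : ∀ i, G i)
    (B : ∀ i, X i → Set (X i)) (hB : ∀ i, MaxMonoOp (B i))
    (D : ∀ i, Y i → Set (Y i)) (hD : ∀ i, MaxMonoOp (D i))
    (L : ∀ i, H →L[ℝ] G i) (hL : ∀ i, L i ≠ 0)
    (K : ∀ i, G i →L[ℝ] X i) (hK : ∀ i, K i ≠ 0)
    (M : ∀ i, G i →L[ℝ] Y i) (hM : ∀ i, M i ≠ 0)
    -- C is μ-Lipschitz continuous
    (hClip : ∀ x y : H, ‖C x - C y‖ ≤ μ * ‖x - y‖)
    -- range condition
    (hran : ∃ (x : H) (u : H) (w : ∀ i, G i), u ∈ A x ∧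
        (∀ i, w i ∈ parOp (compOp (K i) (B i)) (compOp (M i) (D i)) (L i x - r i)) ∧
        z = u + ∑ i, ContinuousLinearMap.adjoint (L i) (w i) + C x)
    -- the constant β
    (β : ℝ)
    (hβ : ∃ s : ℝ, IsGreatest ({∑ i, ‖L i‖ ^ 2} ∪ Set.range (fun j => ‖K j‖ ^ 2) ∪
        Set.range (fun j => ‖M j‖ ^ 2)) s ∧ β = μ + Real.sqrt s)
    -- step sizes
    (ε : ℝ) (hε : ε ∈ Set.Ioo (0:ℝ) (1 / (β + 1)))
    (γ : ℕ → ℝ) (hγ : ∀ n, γ n ∈ Set.Icc ε ((1 - ε) / β))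
    -- the sequences generated by Algorithm 3.4
    (x xt : ℕ → H)
    (p pt : ℕ → ∀ i, X i) (q qt : ℕ → ∀ i, Y i)
    (zz zt y yt v vt u1 u2 : ℕ → ∀ i, G i)
    (hxt : ∃ j : ℕ → H,
      (∀ n, IsRes (γ n) A
        (x n - γ n • (C (x n) + ∑ i, ContinuousLinearMap.adjoint (L i) (v n i) - z)) (j n)) ∧
      Summable (fun n => ‖xt n - j n‖))
    (hpt : ∀ i, ∃ j : ℕ → X i,
      (∀ n, IsRes (γ n) (invOp (B i)) (p n i + γ n • K i (zz n i)) (j n)) ∧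
      Summable (fun n => ‖pt n i - j n‖))
    (hqt : ∀ i, ∃ j : ℕ → Y i,
      (∀ n, IsRes (γ n) (invOp (D i)) (q n i + γ n • M i (y n i)) (j n)) ∧
      Summable (fun n => ‖qt n i - j n‖))
    (hu1 : ∀ i, Summable (fun n => ‖u1 n i - (zz n i - γ n •
        (ContinuousLinearMap.adjoint (K i) (p n i) - v n i - γ n • (L i (x n) - r i)))‖))
    (hu2 : ∀ i, Summable (fun n => ‖u2 n i - (y n i - γ n •
        (ContinuousLinearMap.adjoint (M i) (q n i) - v n i - γ n • (L i (x n) - r i)))‖))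
    (hzt : ∀ i, Summable (fun n => ‖zt n i -
        ((1 + γ n ^ 2) / (1 + 2 * γ n ^ 2)) •
          (u1 n i - (γ n ^ 2 / (1 + γ n ^ 2)) • u2 n i)‖))
    (hyt : ∀ i, Summable (fun n => ‖yt n i -
        (1 / (1 + γ n ^ 2)) • (u2 n i - γ n ^ 2 • zt n i)‖))
    (hvt : ∀ i, Summable (fun n => ‖vt n i -
        (v n i + γ n • (L i (x n) - r i - zt n i - yt n i))‖))
    (hx : Summable (fun n => ‖x (n+1) - (xt n + γ n • (C (x n) - C (xt n) +
        ∑ i, ContinuousLinearMap.adjoint (L i) (v n i - vt n i)))‖))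
    (hp : ∀ i, Summable (fun n => ‖p (n+1) i - (pt n i - γ n • K i (zz n i - zt n i))‖))
    (hq : ∀ i, Summable (fun n => ‖q (n+1) i - (qt n i - γ n • M i (y n i - yt n i))‖))
    (hz : ∀ i, Summable (fun n => ‖zz (n+1) i - (zt n i + γ n •
        ContinuousLinearMap.adjoint (K i) (p n i - pt n i))‖))
    (hy : ∀ i, Summable (fun n => ‖y (n+1) i - (yt n i + γ n •
        ContinuousLinearMap.adjoint (M i) (q n i - qt n i))‖))
    (hv : ∀ i, Summable (fun n => ‖v (n+1) i - (vt n i - γ n • L i (x n - xt n))‖))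
    :
    Summable (fun n => ‖x n - xt n‖ ^ 2) ∧
    (∀ i, Summable (fun n => ‖p n i - pt n i‖ ^ 2)) ∧
    (∀ i, Summable (fun n => ‖q n i - qt n i‖ ^ 2)) ∧
    (∀ i, Summable (fun n => ‖y n i - yt n i‖ ^ 2)) := by
  obtain ⟨xbar, ubar, wbar, hubar, hwbar, hzbar⟩ := hran
  choose zb hzb yb hyb hbar using hwbar
  choose pbar hpbar hKp using hzb
  choose qbar hqbar hMq using hyb
  obtain rfl : wbar = fun i => (K i).adjoint (pbar i) := funext fun i => (hKp i).symm
  obtain ⟨s, ⟨-, hs⟩, rfl⟩ := hβ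
  have hsL : ∑ i, ‖L i‖ ^ 2 ≤ s := hs (.inl (.inl rfl))
  have hsK (i) : ‖K i‖ ^ 2 ≤ s := hs (.inl (.inr ⟨i, rfl⟩))
  have hsM (i) : ‖M i‖ ^ 2 ≤ s := hs (.inr ⟨i, rfl⟩)
  set β := μ + Real.sqrt s
  have hβ : 0 < β := by positivity
  have hε1 : ε < 1 := hε.2.trans ((div_lt_one (by positivity)).2 (by linarith))
  have hγ0 (n) : 0 ≤ γ n := hε.1.le.trans (hγ n).1
  have hγβ (n) : γ n * β ≤ 1 - ε := (le_div_iff₀ hβ).1 (hγ n).2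
  obtain ⟨xj, hxj, hxts⟩ := hxt
  choose pj hpj hpts using hpt
  choose qj hqj hqts using hqt
  let U₁ (n : ℕ) (i) := zz n i - γ n • ((K i).adjoint (p n i) - v n i - γ n • (L i (x n) - r i))
  let U₂ (n : ℕ) (i) := y n i - γ n • ((M i).adjoint (q n i) - v n i - γ n • (L i (x n) - r i))
  obtain ⟨Z, hZ⟩ : ∃ Z : ℕ → ∀ i, G i, ∀ n i, Z n i =
      ((1 + γ n ^ 2) / (1 + 2 * γ n ^ 2)) • (U₁ n i - (γ n ^ 2 / (1 + γ n ^ 2)) • U₂ n i) :=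
    ⟨_, fun _ _ => rfl⟩
  obtain ⟨W, hW⟩ : ∃ W : ℕ → ∀ i, G i, ∀ n i, W n i =
      (1 / (1 + γ n ^ 2)) • (U₂ n i - γ n ^ 2 • Z n i) := ⟨_, fun _ _ => rfl⟩
  obtain ⟨V, hV⟩ : ∃ V : ℕ → ∀ i, G i, ∀ n i, V n i =
      v n i + γ n • (L i (x n) - r i - Z n i - W n i) := ⟨_, fun _ _ => rfl⟩
  have hZW (i) : (Summable fun n => ‖zt n i - Z n i‖) ∧ Summable fun n => ‖yt n i - W n i‖ :=
    summable_norm_sub_resolvent_pair (fun n => sq_nonneg (γ n)) (hu1 i) (hu2 i) (hZ · i)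
      (hW · i) (hzt i) (hyt i)
  have hVs (i) : Summable fun n => ‖vt n i - V n i‖ := by
    refine Summable.of_nonneg_of_le (fun _ => norm_nonneg _) (fun n => ?_)
      ((hvt i).add (((hZW i).1.add (hZW i).2).mul_left ((1 - ε) / β)))
    have e : vt n i - V n i = (vt n i - (v n i + γ n • (L i (x n) - r i - zt n i - yt n i))) -
        γ n • ((zt n i - Z n i) + (yt n i - W n i)) := by
      rw [hV]; module
    rw [e]
    refine norm_sub_le_of_le le_rfl ?_
    rw [norm_smul, Real.norm_of_nonneg (hγ0 n)]
    have := (hγ0 n).trans (hγ n).2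
    gcongr
    · exact (hγ n).2
    · exact norm_add_le _ _
  have key := summable_sq_norm_sub_of_forward_backward_forward (ε := ε) (γ := γ)
    (norm_primalDualOp_sub_le hμ.le hClip hsL hsK hsM)
    (w := fun n => primalDualMk (x n) fun i => dualMk (p n i) (q n i) (zz n i) (y n i) (v n i))
    (wt := fun n =>
      primalDualMk (xt n) fun i => dualMk (pt n i) (qt n i) (zt n i) (yt n i) (vt n i))
    (t := fun n => primalDualMk (xj n) fun i => dualMk (pj i n) (qj i n) (Z n i) (W n i) (V n i))
    (wbar := primalDualMk xbar fun i =>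
      dualMk (pbar i) (qbar i) (zb i) (yb i) ((K i).adjoint (pbar i)))
    ⟨hε.1, hε1⟩ hγ0 hγβ (fun n => ?_) ?_ ?_
  · obtain ⟨hxs, hdual⟩ := summable_sq_norm_of_primalDualMk key
    exact ⟨hxs, fun i => (summable_sq_norm_of_dualMk (hdual i)).1,
      fun i => (summable_sq_norm_of_dualMk (hdual i)).2.1,
      fun i => (summable_sq_norm_of_dualMk (hdual i)).2.2⟩
  · have hpair (i) := resolvent_pair_eq (sq_nonneg (γ n)) (hZ n i) (hW n i)
    refine inner_primalDualOp_nonneg hA.1 (fun i => (hB i).1) (fun i => (hD i).1) hCmono (hγ0 n)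
      (hxj n) (fun i => hpj i n) (fun i => hqj i n) (fun i => (hpair i).1) (fun i => (hpair i).2)
      (hV n) ?_ hpbar hqbar (fun i => (hMq i).trans (hKp i).symm) hbar
    rw [hzbar]
    convert hubar using 1
    abel
  · simp only [primalDualMk_sub, dualMk_sub]
    exact summable_norm_primalDualMk hxts fun i =>
      summable_norm_dualMk (hpts i) (hqts i) (hZW i).1 (hZW i).2 (hVs i)
  · simp only [primalDualOp_mk, primalDualMk_sub, dualMk_sub, smul_primalDualMk, smul_dualMk,
      primalDualMk_add, dualMk_add]
    refine summable_norm_primalDualMk ?_ fun i => summable_norm_dualMk ?_ ?_ ?_ ?_ ?_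
    · simpa only [map_sub, Finset.sum_sub_distrib, add_sub_add_comm] using hx
    · simpa only [map_sub, neg_sub_neg, sub_eq_add_neg (pt _ i), ← smul_neg, neg_sub] using hp i
    · simpa only [map_sub, neg_sub_neg, sub_eq_add_neg (qt _ i), ← smul_neg, neg_sub] using hq i
    · simpa only [map_sub] using hz i
    · simpa only [map_sub] using hy i
    · simpa only [map_sub, neg_sub_neg, sub_eq_add_neg (vt _ i), ← smul_neg, neg_sub] using hv i
end
end

section
/- Let C : H → H be μ-Lipschitz continuous for μ > 0 and suppose z ∈ ran(A + Σ_{i=1}^m L_i*((K_i* ∘ B_i ∘ K_i) □ (M_i* ∘ D_i ∘ M_i))(L_i · − r_i) + C). Then for the sequences generated by Algorithm 3.4 there exists a primal-dual solution (x̄, p̄, q̄, ȳ) to Problem 1.1 such that x_n ⇀ x̄ and x̃_n ⇀ x̄ weakly in H, and for every i = 1,…,m both p_{i,n} ⇀ p̄_i and p̃_{i,n} ⇀ p̄_i weakly in X_i, both q_{i,n} ⇀ q̄_i and q̃_{i,n} ⇀ q̄_i weakly in Y_i, and both y_{i,n} ⇀ ȳ_i and ỹ_{i,n} ⇀ ȳ_i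 weakly in G_i as n → +∞. -/
open scoped RealInnerProductSpace
open Filter Topology

noncomputable section

section Minty

variable {E : Type*} [NormedAddCommGroup E] [InnerProductSpace ℝ E]

theorem MaxMonoOp.mem_of_forall {A : E → Set E} (hA : MaxMonoOp A) {x u : E}
    (h : ∀ a b, b ∈ A a → (0:ℝ) ≤ ⟪x - a, u - b⟫) : u ∈ A x := by
  have hB : MonoOp (fun y => {w | w ∈ A y ∨ (y = x ∧ w = u)}) := by
    rintro x₁ x₂ u₁ u₂ (h₁ | ⟨rfl, rfl⟩) (h₂ | ⟨rfl, rfl⟩)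
    · exact hA.1 h₁ h₂
    · have := h _ _ h₁
      rwa [← neg_sub x₁, ← neg_sub u₁, inner_neg_neg] at this
    · exact h _ _ h₂
    · simp
  rw [← hA.2 _ hB fun _ _ => Or.inl]
  exact Or.inr ⟨rfl, rfl⟩

theorem MaxMonoOp.exists_mem {A : E → Set E} (hA : MaxMonoOp A) : ∃ a b, b ∈ A a := by
  by_contra! h
  exact h 0 0 (hA.mem_of_forall fun a b hb => absurd hb (h a b))

theorem MaxMonoOp.invOp {A : E → Set E} (hA : MaxMonoOp A) : MaxMonoOp (invOp A) := by
  constructor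
  · intro x y u v hu hv
    rw [real_inner_comm]
    exact hA.1 hu hv
  · intro B hB hAB
    have hB' : MonoOp (_root_.invOp B) := by
      intro x y u v hu hv
      rw [real_inner_comm]
      exact hB hu hv
    have := hA.2 _ hB' fun x u hu => hAB u hu
    funext u
    ext x
    exact Set.ext_iff.1 (congrFun this x) u

/-- `t` dominates the Fitzpatrick function of `A` at `(x, u)`. -/
def FitzLE (A : E → Set E) (x u : E) (t : ℝ) : Prop :=
  ∀ a b, b ∈ A a → ⟪x, b⟫ + ⟪a, u⟫ - ⟪a, b⟫ ≤ t

theorem FitzLE.inner_le {A : E → Set E} (hA : MaxMonoOp A) {x u : E} {t : ℝ}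
    (h : FitzLE A x u t) : ⟪x, u⟫ ≤ t := by
  by_contra! hlt
  have hmem : u ∈ A x := hA.mem_of_forall fun a b hb => by
    have := h a b hb
    simp only [inner_sub_left, inner_sub_right]
    linarith
  have := h x u hmem
  linarith

theorem FitzLE.of_mem {A : E → Set E} (hA : MonoOp A) {x u : E} (h : u ∈ A x) :
    FitzLE A x u ⟪x, u⟫ := by
  intro a b hb
  have := hA h hb
  simp only [inner_sub_left, inner_sub_right] at this
  linarith

theorem FitzLE.combo {A : E → Set E} {x u x' u' : E} {t t' s : ℝ}
    (h : FitzLE A x u t) (h' : FitzLE A x' u' t') (h0 : 0 ≤ s) (h1 : s ≤ 1) :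
    FitzLE A (x + s • (x' - x)) (u + s • (u' - u)) (t + s * (t' - t)) := by
  intro a b hb
  have e1 := mul_le_mul_of_nonneg_left (h a b hb) (sub_nonneg.2 h1)
  have e2 := mul_le_mul_of_nonneg_left (h' a b hb) h0
  simp only [inner_add_left, inner_add_right, inner_smul_left, inner_smul_right, inner_sub_left,
    inner_sub_right, RCLike.conj_to_real]
  linarith

theorem FitzLE.of_tendsto {A : E → Set E} {x u : ℕ → E} {t : ℕ → ℝ} {x₀ u₀ : E} {t₀ : ℝ}
    (h : ∀ n, FitzLE A (x n) (u n) (t n)) (hx : Tendsto x atTop (𝓝 x₀))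
    (hu : Tendsto u atTop (𝓝 u₀)) (ht : Tendsto t atTop (𝓝 t₀)) : FitzLE A x₀ u₀ t₀ := by
  intro a b hb
  exact le_of_tendsto_of_tendsto'
    (((hx.inner tendsto_const_nhds).add (tendsto_const_nhds.inner hu)).sub tendsto_const_nhds)
    ht fun n => h n a b hb

theorem nonneg_of_forall_add_mul_nonneg {p q : ℝ} (h : ∀ s, 0 < s → s ≤ 1 → 0 ≤ p + s * q) :
    0 ≤ p := by
  have ht : Tendsto (fun s : ℝ => p + s * q) (𝓝[>] 0) (𝓝 (p + 0 * q)) :=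
    ((continuous_const.add (continuous_id.mul continuous_const)).tendsto 0).mono_left
      nhdsWithin_le_nhds
  rw [zero_mul, add_zero] at ht
  refine ge_of_tendsto ht ?_
  filter_upwards [Ioc_mem_nhdsGT (zero_lt_one' ℝ)] with s hs using h s hs.1 hs.2

variable [CompleteSpace E]

theorem MaxMonoOp.exists_fitz_minimizer {A : E → Set E} (hA : MaxMonoOp A) :
    ∃ x₀ u₀ t₀, FitzLE A x₀ u₀ t₀ ∧ ∀ x u t, FitzLE A x u t →
      t₀ + ‖x₀‖ ^ 2 / 2 + ‖u₀‖ ^ 2 / 2 ≤ t + ‖x‖ ^ 2 / 2 + ‖u‖ ^ 2 / 2 := by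
  set V : Set ℝ := {c | ∃ x u t, FitzLE A x u t ∧ c = t + ‖x‖ ^ 2 / 2 + ‖u‖ ^ 2 / 2} with hV
  have hne : V.Nonempty := by
    obtain ⟨a, b, hb⟩ := hA.exists_mem
    exact ⟨_, a, b, _, FitzLE.of_mem hA.1 hb, rfl⟩
  have hbdd : BddBelow V := by
    refine ⟨0, ?_⟩
    rintro c ⟨x, u, t, h, rfl⟩
    have h1 := h.inner_le hA
    have h2 := norm_add_sq_real x u
    nlinarith [sq_nonneg ‖x + u‖]
  set m := sInf V
  have hm : ∀ x u t, FitzLE A x u t → m ≤ t + ‖x‖ ^ 2 / 2 + ‖u‖ ^ 2 / 2 :=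
    fun x u t h => csInf_le hbdd ⟨x, u, t, h, rfl⟩
  have hex : ∀ n : ℕ, ∃ x u t, FitzLE A x u t ∧
      t + ‖x‖ ^ 2 / 2 + ‖u‖ ^ 2 / 2 < m + 1 / ((n : ℝ) + 1) := by
    intro n
    obtain ⟨c, ⟨x, u, t, h, rfl⟩, hc⟩ := Real.lt_sInf_add_pos hne (ε := 1 / ((n : ℝ) + 1))
      (by positivity)
    exact ⟨x, u, t, h, hc⟩
  choose x u t hF hlt using hex
  have hdist : ∀ N n k : ℕ, N ≤ n → N ≤ k →
      ‖x n - x k‖ ^ 2 + ‖u n - u k‖ ^ 2 ≤ 8 * (1 / ((N : ℝ) + 1)) := by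
    intro N n k hn hk
    have h1 := hm _ _ _ ((hF n).combo (hF k) (s := 1 / 2) (by norm_num) (by norm_num))
    have h2 := hlt n
    have h3 := hlt k
    have h4 : 1 / ((n : ℝ) + 1) ≤ 1 / ((N : ℝ) + 1) := Nat.one_div_le_one_div hn
    have h5 : 1 / ((k : ℝ) + 1) ≤ 1 / ((N : ℝ) + 1) := Nat.one_div_le_one_div hk
    have par : ∀ w w' : E, ‖w + (1 / 2 : ℝ) • (w' - w)‖ ^ 2 =
        ‖w‖ ^ 2 / 2 + ‖w'‖ ^ 2 / 2 - ‖w - w'‖ ^ 2 / 4 := by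
      intro w w'
      simp only [← real_inner_self_eq_norm_sq, inner_add_left, inner_add_right, inner_smul_left,
        inner_smul_right, inner_sub_left, inner_sub_right, RCLike.conj_to_real,
        real_inner_comm w w']
      ring
    rw [par, par] at h1
    linarith
  have hb : Tendsto (fun N : ℕ => √(8 * (1 / ((N : ℝ) + 1)))) atTop (𝓝 0) := by
    have := ((tendsto_one_div_add_atTop_nhds_zero_nat (𝕜 := ℝ)).const_mul 8).sqrt
    simpa using this
  have hxc : CauchySeq x := cauchySeq_of_le_tendsto_0 _ (fun n k N hn hk => by
    rw [dist_eq_norm]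
    exact Real.le_sqrt_of_sq_le (by nlinarith [hdist N n k hn hk, sq_nonneg ‖u n - u k‖])) hb
  have huc : CauchySeq u := cauchySeq_of_le_tendsto_0 _ (fun n k N hn hk => by
    rw [dist_eq_norm]
    exact Real.le_sqrt_of_sq_le (by nlinarith [hdist N n k hn hk, sq_nonneg ‖x n - x k‖])) hb
  obtain ⟨x₀, hx₀⟩ := cauchySeq_tendsto_of_complete hxc
  obtain ⟨u₀, hu₀⟩ := cauchySeq_tendsto_of_complete huc
  have hval : Tendsto (fun n => t n + ‖x n‖ ^ 2 / 2 + ‖u n‖ ^ 2 / 2) atTop (𝓝 m) := by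
    refine tendsto_of_tendsto_of_tendsto_of_le_of_le tendsto_const_nhds ?_
      (fun n => hm _ _ _ (hF n)) (fun n => (hlt n).le)
    simpa using (tendsto_one_div_add_atTop_nhds_zero_nat (𝕜 := ℝ)).const_add m
  have ht : Tendsto t atTop (𝓝 (m - ‖x₀‖ ^ 2 / 2 - ‖u₀‖ ^ 2 / 2)) := by
    have := (hval.sub ((hx₀.norm.pow 2).div_const 2)).sub ((hu₀.norm.pow 2).div_const 2)
    refine (this.congr fun n => ?_)
    ring
  refine ⟨x₀, u₀, _, FitzLE.of_tendsto hF hx₀ hu₀ ht, fun x u t h => ?_⟩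
  linarith [hm x u t h]

theorem MaxMonoOp.exists_neg_mem {A : E → Set E} (hA : MaxMonoOp A) : ∃ x, -x ∈ A x := by
  obtain ⟨x₀, u₀, t₀, hF, hmin⟩ := hA.exists_fitz_minimizer
  have hopt : ∀ x u t, FitzLE A x u t → 0 ≤ (t - t₀) + ⟪x₀, x - x₀⟫ + ⟪u₀, u - u₀⟫ := by
    intro x u t h
    refine nonneg_of_forall_add_mul_nonneg (q := ‖x - x₀‖ ^ 2 / 2 + ‖u - u₀‖ ^ 2 / 2) ?_
    intro s hs hs1
    have h1 := hmin _ _ _ (hF.combo h hs.le hs1)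
    rw [norm_add_sq_real, norm_add_sq_real, inner_smul_right, inner_smul_right, norm_smul,
      norm_smul, mul_pow, mul_pow, Real.norm_eq_abs, sq_abs] at h1
    refine nonneg_of_mul_nonneg_right (a := s) ?_ hs
    nlinarith
  have hsum : (0:ℝ) ≤ ‖x₀ + u₀‖ ^ 2 := sq_nonneg _
  have key : ∀ a b, b ∈ A a → ‖x₀ + u₀‖ ^ 2 ≤ ⟪-u₀ - a, -x₀ - b⟫ := by
    intro a b hb
    have h1 := hopt a b _ (FitzLE.of_mem hA.1 hb)
    have h2 := hF.inner_le hA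
    rw [norm_add_sq_real]
    simp only [inner_sub_left, inner_sub_right, inner_neg_left, inner_neg_right,
      real_inner_self_eq_norm_sq] at h1 ⊢
    linarith [real_inner_comm x₀ a, real_inner_comm x₀ u₀]
  have hmem : -x₀ ∈ A (-u₀) := hA.mem_of_forall fun a b hb => hsum.trans (key a b hb)
  have h0 := key _ _ hmem
  rw [sub_self, inner_zero_left] at h0
  have : x₀ + u₀ = 0 := by
    rw [← norm_eq_zero]
    exact pow_eq_zero_iff (two_ne_zero) |>.1 (le_antisymm h0 hsum)
  have hu : -u₀ = x₀ := neg_eq_of_add_eq_zero_left this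
  rw [hu] at hmem
  exact ⟨x₀, hmem⟩

/-- **Minty's theorem**: resolvents of maximally monotone operators are everywhere defined. -/
theorem MaxMonoOp.exists_isRes {A : E → Set E} (hA : MaxMonoOp A) {γ : ℝ} (hγ : 0 < γ) (w : E) :
    ∃ x, IsRes γ A w x := by
  have hA' : MaxMonoOp (fun y => {s | ∃ u ∈ A (y + w), s = γ • u}) := by
    constructor
    · rintro x y _ _ ⟨u, hu, rfl⟩ ⟨v, hv, rfl⟩
      rw [← smul_sub, inner_smul_right]
      have := hA.1 hu hv
      rw [add_sub_add_right_eq_sub] at this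
      positivity
    · intro B hB hAB
      funext y
      ext s
      refine ⟨fun hs => ⟨γ⁻¹ • s, hA.mem_of_forall fun a b hb => ?_, by simp [hγ.ne']⟩,
        fun hs => hAB y hs⟩
      have := hB hs (hAB (a - w) (show γ • b ∈ _ from ⟨b, by simpa using hb, rfl⟩))
      have e : γ⁻¹ • s - b = γ⁻¹ • (s - γ • b) := by
        rw [smul_sub, inv_smul_smul₀ hγ.ne']
      rw [e, inner_smul_right]
      have e2 : y + w - a = y - (a - w) := by abel
      rw [e2]
      positivity
  obtain ⟨x, u, hu, hxu⟩ := hA'.exists_neg_mem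
  exact ⟨x + w, u, hu, by simp [← hxu]⟩

end Minty

section WeakConvergence

variable {E : Type*} [NormedAddCommGroup E] [InnerProductSpace ℝ E]

theorem WConv.of_sub_tendsto_zero {u u' : ℕ → E} {l : E} (h : WConv u l)
    (hd : Tendsto (fun n => u' n - u n) atTop (𝓝 0)) : WConv u' l := by
  intro w
  have := (h w).add (hd.inner (tendsto_const_nhds (x := w)))
  rw [inner_zero_left, add_zero] at this
  refine this.congr fun n => ?_
  rw [← inner_add_left, add_sub_cancel]

theorem exists_ultrafilter_weak_limit [CompleteSpace E] {u : ℕ → E} {R : ℝ}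
    (hu : ∀ n, ‖u n‖ ≤ R) (U : Ultrafilter ℕ) :
    ∃ l, ∀ w, Tendsto (fun n => ⟪u n, w⟫) U (𝓝 ⟪l, w⟫) := by
  let f : ℕ → WeakDual ℝ E := fun n => StrongDual.toWeakDual (InnerProductSpace.toDual ℝ E (u n))
  obtain ⟨φ, -, hφ⟩ := (WeakDual.isCompact_closedBall (0 : StrongDual ℝ E) R).ultrafilter_le_nhds
    (U.map f) (by
      rw [Filter.le_principal_iff]
      refine Filter.mem_map.2 (Filter.univ_mem' fun n => ?_)
      have : ‖InnerProductSpace.toDual ℝ E (u n)‖ ≤ R := by simpa using hu n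
      simpa [f] using this)
  refine ⟨(InnerProductSpace.toDual ℝ E).symm (WeakDual.toStrongDual φ), fun w => ?_⟩
  rw [InnerProductSpace.toDual_symm_apply]
  have h1 : Tendsto f U (𝓝 φ) := hφ
  exact ((WeakDual.eval_continuous w).tendsto φ).comp h1

/-- **Opial's lemma**, formulated with ultrafilters instead of subsequences. -/
theorem exists_wConv_of_opial [CompleteSpace E] {u : ℕ → E} {S : Set E} (hS : S.Nonempty)
    (hnorm : ∀ w ∈ S, ∃ c, Tendsto (fun n => ‖u n - w‖) atTop (𝓝 c))
    (hcluster : ∀ (U : Ultrafilter ℕ) (l : E), (U : Filter ℕ) ≤ atTop →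
      (∀ w, Tendsto (fun n => ⟪u n, w⟫) U (𝓝 ⟪l, w⟫)) → l ∈ S) :
    ∃ l ∈ S, WConv u l := by
  obtain ⟨w₀, hw₀⟩ := hS
  obtain ⟨R, hR⟩ : ∃ R, ∀ n, ‖u n‖ ≤ R := by
    obtain ⟨c, hc⟩ := hnorm w₀ hw₀
    obtain ⟨R, hR⟩ := hc.bddAbove_range
    refine ⟨R + ‖w₀‖, fun n => ?_⟩
    have := hR ⟨n, rfl⟩
    have h2 := norm_add_le (u n - w₀) w₀
    rw [sub_add_cancel] at h2
    simp only at this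
    linarith
  have huniq : ∀ (U V : Ultrafilter ℕ) (l l' : E), (U : Filter ℕ) ≤ atTop →
      (V : Filter ℕ) ≤ atTop → (∀ w, Tendsto (fun n => ⟪u n, w⟫) U (𝓝 ⟪l, w⟫)) →
      (∀ w, Tendsto (fun n => ⟪u n, w⟫) V (𝓝 ⟪l', w⟫)) → l = l' := by
    intro U V l l' hU hV hl hl'
    obtain ⟨c, hc⟩ := hnorm l (hcluster U l hU hl)
    obtain ⟨c', hc'⟩ := hnorm l' (hcluster V l' hV hl')
    have hlim : Tendsto (fun n => ⟪u n, l - l'⟫) atTop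
        (𝓝 ((c' ^ 2 - c ^ 2 + ‖l‖ ^ 2 - ‖l'‖ ^ 2) / 2)) := by
      refine (((((hc'.pow 2).sub (hc.pow 2)).add_const (‖l‖ ^ 2)).sub_const
        (‖l'‖ ^ 2)).div_const 2).congr fun n => ?_
      rw [norm_sub_sq_real, norm_sub_sq_real, inner_sub_right]
      ring
    have e : ⟪l, l - l'⟫ = ⟪l', l - l'⟫ :=
      (tendsto_nhds_unique (hl _) (hlim.mono_left hU)).trans
        (tendsto_nhds_unique (hlim.mono_left hV) (hl' _))
    rw [← sub_eq_zero, ← inner_self_eq_zero (𝕜 := ℝ), inner_sub_left, e, sub_self]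
  obtain ⟨l, hl⟩ := exists_ultrafilter_weak_limit hR (Ultrafilter.of atTop)
  refine ⟨l, hcluster _ _ (Ultrafilter.of_le _) hl, fun w => ?_⟩
  rw [Filter.tendsto_iff_ultrafilter]
  intro V hV
  obtain ⟨l', hl'⟩ := exists_ultrafilter_weak_limit hR V
  obtain rfl := huniq _ V l l' (Ultrafilter.of_le _) hV hl hl'
  exact hl' w

end WeakConvergence

section ForwardBackwardForward

theorem exists_tendsto_of_le_add_summable {a e : ℕ → ℝ} (ha : ∀ n, 0 ≤ a n)
    (he : Summable e) (h : ∀ n, a (n + 1) ≤ a n + e n) : ∃ c, Tendsto a atTop (𝓝 c) := by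
  have hlim := he.hasSum.tendsto_sum_nat
  obtain ⟨R, hR⟩ := hlim.bddAbove_range
  have hanti : Antitone (fun n => a n - ∑ k ∈ Finset.range n, e k) :=
    antitone_nat_of_succ_le fun n => by
      rw [Finset.sum_range_succ]
      linarith [h n]
  have hbdd : BddBelow (Set.range fun n => a n - ∑ k ∈ Finset.range n, e k) := by
    refine ⟨-R, ?_⟩
    rintro _ ⟨n, rfl⟩
    have := hR ⟨n, rfl⟩
    simp only at this ⊢
    linarith [ha n]
  refine ⟨_, ((tendsto_atTop_ciInf hanti hbdd).add hlim).congr fun n => ?_⟩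
  ring

variable {E : Type*} [NormedAddCommGroup E] [InnerProductSpace ℝ E]

/-- One step of Tseng's forward-backward-forward method, relative to a zero `w` of `M + Q`. -/
theorem fbf_step_norm_sq_le {M : E → Set E} (hM : MonoOp M) {Q : E → E}
    (hQ : ∀ x y, (0:ℝ) ≤ ⟪x - y, Q x - Q y⟫) {β γ : ℝ} (hγ : 0 < γ)
    (hlip : ∀ x y, ‖Q x - Q y‖ ≤ β * ‖x - y‖) {x j w : E}
    (hj : IsRes γ M (x - γ • Q x) j) (hw : -Q w ∈ M w) :
    ‖j + γ • (Q x - Q j) - w‖ ^ 2 ≤ ‖x - w‖ ^ 2 - (1 - (γ * β) ^ 2) * ‖x - j‖ ^ 2 := by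
  obtain ⟨u, hu, hxu⟩ := hj
  have hx : x = j + γ • u + γ • Q x := by
    simp only at hxu
    rw [hxu]
    abel
  have h1 := hM hu hw
  have h2 := hQ j w
  have h3 : (0:ℝ) ≤ γ * ⟪j - w, u + Q j⟫ := by
    refine mul_nonneg hγ.le ?_
    have := add_nonneg h1 h2
    rw [← inner_add_right] at this
    convert this using 2
    abel
  have hT : j + γ • (Q x - Q j) - w = (x - w) - γ • (u + Q j) := by
    nth_rw 2 [hx]
    module
  have hg : γ • (Q x - Q j) = (x - j) - γ • (u + Q j) := by
    nth_rw 2 [hx]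
    module
  have h4 : ‖γ • (Q x - Q j)‖ ^ 2 ≤ (γ * β) ^ 2 * ‖x - j‖ ^ 2 := by
    rw [norm_smul, Real.norm_of_nonneg hγ.le, ← mul_pow, mul_assoc]
    gcongr
    exact hlip x j
  rw [hg, norm_sub_sq_real, inner_smul_right] at h4
  rw [hT, norm_sub_sq_real, inner_smul_right]
  have h5 : ⟪x - w, u + Q j⟫ = ⟪x - j, u + Q j⟫ + ⟪j - w, u + Q j⟫ := by
    rw [← inner_add_left, sub_add_sub_cancel]
  rw [h5]
  linarith

/-- If resolvents of `M` are everywhere defined and `Q` is Lipschitz, then `M + Q` cannot be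
extended at `0`. -/
theorem neg_mem_of_forall_inner_nonneg [CompleteSpace E] {M : E → Set E} (hM : MonoOp M)
    (hres : ∀ γ : ℝ, 0 < γ → ∀ w, ∃ x, IsRes γ M w x) {Q : E → E} {β : ℝ} (hβ : 0 < β)
    (hlip : ∀ x y, ‖Q x - Q y‖ ≤ β * ‖x - y‖) {l : E}
    (h : ∀ a u, u ∈ M a → (0:ℝ) ≤ ⟪l - a, -(u + Q a)⟫) : -Q l ∈ M l := by
  set c : ℝ := 1 / (2 * β) with hc
  have hc0 : 0 < c := by positivity
  choose J hJ using hres c hc0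
  have hJlip : ∀ w w', ‖J w - J w'‖ ≤ ‖w - w'‖ := by
    intro w w'
    obtain ⟨u, hu, e⟩ := hJ w
    obtain ⟨u', hu', e'⟩ := hJ w'
    have h1 := mul_nonneg hc0.le (hM hu hu')
    rw [← inner_smul_right, smul_sub] at h1
    simp only at e e'
    rw [e, e', show w - J w - (w' - J w') = (w - w') - (J w - J w') by abel, inner_sub_right,
      real_inner_self_eq_norm_sq] at h1
    have h2 := real_inner_le_norm (J w - J w') (w - w')
    by_contra! hlt
    nlinarith [norm_nonneg (w - w')]
  have hcontr : ContractingWith (1 / 2) (fun a => J (l - c • Q a)) := by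
    refine ⟨by rw [← NNReal.coe_lt_coe]; norm_num, LipschitzWith.of_dist_le_mul fun a b => ?_⟩
    rw [dist_eq_norm, dist_eq_norm]
    refine (hJlip _ _).trans ?_
    rw [show l - c • Q a - (l - c • Q b) = c • (Q b - Q a) by module, norm_smul,
      Real.norm_of_nonneg hc0.le, norm_sub_rev (Q b)]
    have := mul_le_mul_of_nonneg_left (hlip a b) hc0.le
    have e : c * (β * ‖a - b‖) = 1 / 2 * ‖a - b‖ := by
      rw [hc]; field_simp
    rw [e] at this
    simpa using this
  have hfix := hcontr.fixedPoint_isFixedPt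
  set a := hcontr.fixedPoint
  have hfix' : J (l - c • Q a) = a := hfix
  obtain ⟨u, hu, e⟩ := hJ (l - c • Q a)
  rw [hfix'] at hu e
  have e' : l - a = c • (u + Q a) := by
    simp only at e
    rw [smul_add, e]
    abel
  have h1 := h a u hu
  rw [e', inner_neg_right, inner_smul_left, real_inner_self_eq_norm_sq] at h1
  have h2 : u + Q a = 0 := by
    rw [← norm_eq_zero]
    refine pow_eq_zero_iff (two_ne_zero) |>.1 (le_antisymm ?_ (sq_nonneg _))
    simp only [RCLike.conj_to_real] at h1
    nlinarith [sq_nonneg ‖u + Q a‖]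
  rw [h2, smul_zero, sub_eq_zero] at e'
  rw [e', ← eq_neg_of_add_eq_zero_left h2]
  exact hu

/-- Weak convergence of the inexact forward-backward-forward method. -/
theorem exists_wConv_fbf [CompleteSpace E] {M : E → Set E} (hM : MonoOp M)
    (hres : ∀ γ : ℝ, 0 < γ → ∀ w, ∃ x, IsRes γ M w x) {Q : E → E}
    (hQ : ∀ x y, (0:ℝ) ≤ ⟪x - y, Q x - Q y⟫) {β : ℝ} (hβ : 0 < β)
    (hlip : ∀ x y, ‖Q x - Q y‖ ≤ β * ‖x - y‖) (hzer : ∃ w, -Q w ∈ M w)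
    {ε : ℝ} (hε : ε ∈ Set.Ioo (0:ℝ) (1 / (β + 1)))
    {γ : ℕ → ℝ} (hγ : ∀ n, γ n ∈ Set.Icc ε ((1 - ε) / β)) {x xt j : ℕ → E}
    (hj : ∀ n, IsRes (γ n) M (x n - γ n • Q (x n)) (j n))
    (hxt : Summable fun n => ‖xt n - j n‖)
    (hx : Summable fun n => ‖x (n + 1) - (xt n + γ n • (Q (x n) - Q (xt n)))‖) :
    ∃ l, -Q l ∈ M l ∧ WConv x l ∧ WConv xt l := by
  have hε0 : 0 < ε := hε.1
  have hε1 : ε < 1 := hε.2.trans (by rw [div_lt_one (by positivity)]; linarith)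
  have hγ0 : ∀ n, 0 < γ n := fun n => hε0.trans_le (hγ n).1
  have hγβ : ∀ n, γ n * β ≤ 1 - ε := fun n => (le_div_iff₀ hβ).1 (hγ n).2
  have hγβ0 : ∀ n, 0 ≤ γ n * β := fun n => mul_nonneg (hγ0 n).le hβ.le
  set T : ℕ → E := fun n => j n + γ n • (Q (x n) - Q (j n)) with hT
  set e : ℕ → ℝ := fun n => ‖x (n + 1) - T n‖ with he
  have hesum : Summable e := by
    refine Summable.of_nonneg_of_le (fun n => norm_nonneg _) (fun n => ?_)
      (hx.add (hxt.mul_left 2))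
    have e1 : x (n + 1) - T n = (x (n + 1) - (xt n + γ n • (Q (x n) - Q (xt n)))) +
        ((xt n - j n) - γ n • (Q (xt n) - Q (j n))) := by
      simp only [hT]
      module
    have e2 : ‖γ n • (Q (xt n) - Q (j n))‖ ≤ ‖xt n - j n‖ := by
      rw [norm_smul, Real.norm_of_nonneg (hγ0 n).le]
      calc γ n * ‖Q (xt n) - Q (j n)‖ ≤ γ n * (β * ‖xt n - j n‖) :=
            mul_le_mul_of_nonneg_left (hlip _ _) (hγ0 n).le
        _ = γ n * β * ‖xt n - j n‖ := by ring
        _ ≤ 1 * ‖xt n - j n‖ := by gcongr; linarith [hγβ n]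
        _ = _ := one_mul _
    simp only [he]
    rw [e1]
    refine (norm_add_le _ _).trans ?_
    linarith [norm_sub_le (xt n - j n) (γ n • (Q (xt n) - Q (j n)))]
  have hstep : ∀ w, -Q w ∈ M w → ∀ n,
      ‖T n - w‖ ^ 2 ≤ ‖x n - w‖ ^ 2 - ε * ‖x n - j n‖ ^ 2 := by
    intro w hw n
    have h1 := fbf_step_norm_sq_le hM hQ (hγ0 n) hlip (hj n) hw
    have h2 : ε ≤ 1 - (γ n * β) ^ 2 := by nlinarith [hγβ n, hγβ0 n]
    have h3 := mul_le_mul_of_nonneg_right h2 (sq_nonneg ‖x n - j n‖)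
    simp only [hT]
    linarith
  have hTle : ∀ w, -Q w ∈ M w → ∀ n, ‖T n - w‖ ≤ ‖x n - w‖ := by
    intro w hw n
    refine (sq_le_sq₀ (norm_nonneg _) (norm_nonneg _)).1 ?_
    have := hstep w hw n
    nlinarith [sq_nonneg ‖x n - j n‖]
  have hconv : ∀ w, -Q w ∈ M w → ∃ c, Tendsto (fun n => ‖x n - w‖) atTop (𝓝 c) := by
    intro w hw
    refine exists_tendsto_of_le_add_summable (fun n => norm_nonneg _) hesum fun n => ?_
    have h1 := norm_add_le (x (n + 1) - T n) (T n - w)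
    rw [sub_add_sub_cancel] at h1
    linarith [hTle w hw n]
  obtain ⟨w₀, hw₀⟩ := hzer
  obtain ⟨c, hc⟩ := hconv w₀ hw₀
  have hxT : Tendsto (fun n => ‖T n - w₀‖) atTop (𝓝 c) := by
    have h1 : Tendsto (fun n => ‖x (n + 1) - w₀‖ - e n) atTop (𝓝 c) := by
      simpa using (hc.comp (tendsto_add_atTop_nat 1)).sub hesum.tendsto_atTop_zero
    refine tendsto_of_tendsto_of_tendsto_of_le_of_le h1 hc (fun n => ?_) (hTle w₀ hw₀)
    have h2 := norm_add_le (x (n + 1) - T n) (T n - w₀)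
    rw [sub_add_sub_cancel] at h2
    simp only [he]
    linarith
  have hxj : Tendsto (fun n => x n - j n) atTop (𝓝 0) := by
    have h1 : Tendsto (fun n => (‖x n - w₀‖ ^ 2 - ‖T n - w₀‖ ^ 2) / ε) atTop (𝓝 0) := by
      simpa using ((hc.pow 2).sub (hxT.pow 2)).div_const ε
    have h2 : Tendsto (fun n => ‖x n - j n‖ ^ 2) atTop (𝓝 0) := by
      refine squeeze_zero (fun n => sq_nonneg _) (fun n => ?_) h1
      rw [le_div_iff₀ hε0]
      linarith [hstep w₀ hw₀ n]
    rw [tendsto_zero_iff_norm_tendsto_zero]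
    simpa [Real.sqrt_sq] using h2.sqrt
  have hjx : Tendsto (fun n => j n - x n) atTop (𝓝 0) := by simpa using hxj.neg
  have hres0 : Tendsto (fun n => (γ n)⁻¹ • (x n - j n) - (Q (x n) - Q (j n))) atTop (𝓝 0) := by
    refine squeeze_zero_norm (a := fun n => (ε⁻¹ + β) * ‖x n - j n‖) (fun n => ?_)
      (by simpa using hxj.norm.const_mul (ε⁻¹ + β))
    refine (norm_sub_le _ _).trans ?_
    rw [norm_smul, add_mul]
    refine add_le_add (mul_le_mul_of_nonneg_right ?_ (norm_nonneg _)) (hlip _ _)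
    rw [norm_inv, Real.norm_of_nonneg (hγ0 n).le]
    exact inv_anti₀ hε0 (hγ n).1
  obtain ⟨R, hR⟩ : ∃ R, ∀ n, ‖j n - w₀‖ ≤ R := by
    obtain ⟨R, hR⟩ := (hc.add hjx.norm).bddAbove_range
    refine ⟨R, fun n => ?_⟩
    have h1 := hR ⟨n, rfl⟩
    have h2 := norm_add_le (j n - x n) (x n - w₀)
    rw [sub_add_sub_cancel] at h2
    simp only at h1
    linarith
  obtain ⟨l, hl, hxl⟩ := exists_wConv_of_opial (S := {w | -Q w ∈ M w}) ⟨w₀, hw₀⟩ hconv (by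
    intro U l hU hl
    refine neg_mem_of_forall_inner_nonneg hM hres hβ hlip fun a u hu => ?_
    have hjU : ∀ w, Tendsto (fun n => ⟪j n, w⟫) U (𝓝 ⟪l, w⟫) := by
      intro w
      have := (hl w).add ((hjx.inner (tendsto_const_nhds (x := w))).mono_left hU)
      rw [inner_zero_left, add_zero] at this
      refine this.congr fun n => ?_
      rw [← inner_add_left, add_sub_cancel]
    have hpos : ∀ n, (0:ℝ) ≤
        ⟪j n - a, ((γ n)⁻¹ • (x n - j n) - (Q (x n) - Q (j n))) - (u + Q a)⟫ := by
      intro n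
      obtain ⟨u', hu', hxu⟩ := hj n
      simp only at hxu
      have e1 : (γ n)⁻¹ • (x n - j n) - (Q (x n) - Q (j n)) = u' + Q (j n) := by
        have : x n - j n = γ n • (u' + Q (x n)) := by
          rw [smul_add, hxu]
          abel
        rw [this, inv_smul_smul₀ (hγ0 n).ne']
        abel
      rw [e1, show u' + Q (j n) - (u + Q a) = (u' - u) + (Q (j n) - Q a) by abel,
        inner_add_right]
      exact add_nonneg (hM hu' hu) (hQ _ _)
    have hsmall : Tendsto (fun n =>
        ⟪j n - a, (γ n)⁻¹ • (x n - j n) - (Q (x n) - Q (j n))⟫) atTop (𝓝 0) := by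
      refine squeeze_zero_norm (a := fun n => (R + ‖w₀ - a‖) *
        ‖(γ n)⁻¹ • (x n - j n) - (Q (x n) - Q (j n))‖) (fun n => ?_)
        (by simpa using hres0.norm.const_mul (R + ‖w₀ - a‖))
      refine (norm_inner_le_norm _ _).trans (mul_le_mul_of_nonneg_right ?_ (norm_nonneg _))
      have h2 := norm_add_le (j n - w₀) (w₀ - a)
      rw [sub_add_sub_cancel] at h2
      linarith [hR n]
    have hlim := ((hjU (-(u + Q a))).sub_const ⟪a, -(u + Q a)⟫).add (hsmall.mono_left hU)
    rw [← inner_sub_left, add_zero] at hlim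
    refine ge_of_tendsto' hlim fun n => (hpos n).trans_eq ?_
    rw [sub_eq_add_neg _ (u + Q a), inner_add_right, ← inner_sub_left]
    ring)
  have hjl := hxl.of_sub_tendsto_zero hjx
  exact ⟨l, hl, hxl, hjl.of_sub_tendsto_zero
    (tendsto_zero_iff_norm_tendsto_zero.2 hxt.tendsto_atTop_zero)⟩

end ForwardBackwardForward

section Product

variable {E F : Type*} [NormedAddCommGroup E] [InnerProductSpace ℝ E]
  [NormedAddCommGroup F] [InnerProductSpace ℝ F]

theorem WConv.fst {u : ℕ → WithLp 2 (E × F)} {l : WithLp 2 (E × F)} (h : WConv u l) :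
    WConv (fun n => (u n).fst) l.fst := fun w => by
  simpa [WithLp.prod_inner_apply] using h (WithLp.toLp 2 (w, 0))

theorem WConv.snd {u : ℕ → WithLp 2 (E × F)} {l : WithLp 2 (E × F)} (h : WConv u l) :
    WConv (fun n => (u n).snd) l.snd := fun w => by
  simpa [WithLp.prod_inner_apply] using h (WithLp.toLp 2 (0, w))

theorem WConv.piLp_apply {ι : Type*} [Fintype ι] {F : ι → Type*}
    [∀ i, NormedAddCommGroup (F i)] [∀ i, InnerProductSpace ℝ (F i)] {u : ℕ → PiLp 2 F}
    {l : PiLp 2 F} (h : WConv u l) (i : ι) : WConv (fun n => u n i) (l i) := fun w => by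
  classical
  have key : ∀ a : PiLp 2 F, ⟪a, WithLp.toLp 2 (Pi.single i w)⟫ = ⟪a i, w⟫ := by
    intro a
    rw [PiLp.inner_apply, Finset.sum_eq_single i]
    · simp
    · intro k _ hk
      simp [Pi.single_eq_of_ne hk]
    · simp
  simpa only [key] using h (WithLp.toLp 2 (Pi.single i w))

theorem PiLp.norm_le_sum {ι : Type*} [Fintype ι] {F : ι → Type*}
    [∀ i, NormedAddCommGroup (F i)] (a : PiLp 2 F) : ‖a‖ ≤ ∑ i, ‖a i‖ := by
  refine (sq_le_sq₀ (norm_nonneg _) (by positivity)).1 ?_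
  rw [PiLp.norm_sq_eq_of_L2]
  exact Finset.sum_sq_le_sq_sum_of_nonneg fun i _ => norm_nonneg _

theorem Summable.norm_piLp {ι : Type*} [Fintype ι] {F : ι → Type*}
    [∀ i, NormedAddCommGroup (F i)] {f : ℕ → PiLp 2 F} (h : ∀ i, Summable fun n => ‖f n i‖) :
    Summable fun n => ‖f n‖ :=
  (summable_sum fun i _ => h i).of_nonneg_of_le (fun _ => norm_nonneg _) fun _ =>
    PiLp.norm_le_sum _

end Product

section Block

theorem norm_sq_le_of_adjoint {E F : Type*} [NormedAddCommGroup E] [InnerProductSpace ℝ E]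
    [NormedAddCommGroup F] [InnerProductSpace ℝ F] {T : E →ₗ[ℝ] F} {T' : F →ₗ[ℝ] E}
    (h : ∀ x v, ⟪T x, v⟫ = ⟪x, T' v⟫) {s : ℝ} (hs : 0 ≤ s) (hT : ∀ x, ‖T x‖ ^ 2 ≤ s * ‖x‖ ^ 2)
    (v : F) : ‖T' v‖ ^ 2 ≤ s * ‖v‖ ^ 2 := by
  rcases (sq_nonneg ‖T' v‖).eq_or_lt with h0 | h0
  · rw [← h0]
    positivity
  · have h1 : ‖T' v‖ ^ 2 ≤ ‖T (T' v)‖ * ‖v‖ := by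
      rw [← real_inner_self_eq_norm_sq, ← h]
      exact real_inner_le_norm _ _
    have h3 : (‖T' v‖ ^ 2) ^ 2 ≤ (s * ‖T' v‖ ^ 2) * ‖v‖ ^ 2 := by
      calc (‖T' v‖ ^ 2) ^ 2 ≤ (‖T (T' v)‖ * ‖v‖) ^ 2 := by gcongr
        _ = ‖T (T' v)‖ ^ 2 * ‖v‖ ^ 2 := by ring
        _ ≤ _ := by gcongr; exact hT _
    nlinarith

/-- The space of tuples `(x, p, q, z, y, v)`. -/
abbrev Tuple (H X Y G : Type*) :=
  WithLp 2 (H × WithLp 2 (X × WithLp 2 (Y × WithLp 2 (G × WithLp 2 (G × G)))))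

namespace Tuple

variable {H X Y G : Type*}

def mk (x : H) (p : X) (q : Y) (z y v : G) : Tuple H X Y G :=
  WithLp.toLp 2 (x, WithLp.toLp 2 (p, WithLp.toLp 2 (q, WithLp.toLp 2 (z, WithLp.toLp 2 (y, v)))))

theorem exists_mk (a : Tuple H X Y G) : ∃ x p q z y v, a = mk x p q z y v :=
  ⟨a.fst, a.snd.fst, a.snd.snd.fst, a.snd.snd.snd.fst, a.snd.snd.snd.snd.fst,
    a.snd.snd.snd.snd.snd, rfl⟩

theorem mk_inj {x x' : H} {p p' : X} {q q' : Y} {z y v z' y' v' : G} :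
    mk x p q z y v = mk x' p' q' z' y' v' ↔
      x = x' ∧ p = p' ∧ q = q' ∧ z = z' ∧ y = y' ∧ v = v' := by
  simp [mk]

section Normed

variable [NormedAddCommGroup H] [NormedAddCommGroup X] [NormedAddCommGroup Y]
  [NormedAddCommGroup G]

theorem mk_add (x x' : H) (p p' : X) (q q' : Y) (z y v z' y' v' : G) :
    mk x p q z y v + mk x' p' q' z' y' v' =
      mk (x + x') (p + p') (q + q') (z + z') (y + y') (v + v') := rfl

theorem mk_sub (x x' : H) (p p' : X) (q q' : Y) (z y v z' y' v' : G) :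
    mk x p q z y v - mk x' p' q' z' y' v' =
      mk (x - x') (p - p') (q - q') (z - z') (y - y') (v - v') := rfl

theorem norm_sq_mk (x : H) (p : X) (q : Y) (z y v : G) :
    ‖mk x p q z y v‖ ^ 2 =
      ‖x‖ ^ 2 + (‖p‖ ^ 2 + (‖q‖ ^ 2 + (‖z‖ ^ 2 + (‖y‖ ^ 2 + ‖v‖ ^ 2)))) := by
  simp only [mk, WithLp.prod_norm_sq_eq_of_L2]
  rfl

theorem norm_mk_le (x : H) (p : X) (q : Y) (z y v : G) :
    ‖mk x p q z y v‖ ≤ ‖x‖ + (‖p‖ + (‖q‖ + (‖z‖ + (‖y‖ + ‖v‖)))) := by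
  have key : ∀ a b c : ℝ, 0 ≤ a → 0 ≤ b → c ≤ b ^ 2 → a ^ 2 + c ≤ (a + b) ^ 2 :=
    fun a b c ha hb hc => by nlinarith
  refine (sq_le_sq₀ (norm_nonneg _) (by positivity)).1 ?_
  rw [norm_sq_mk]
  refine key _ _ _ (by positivity) (by positivity) ?_
  refine key _ _ _ (by positivity) (by positivity) ?_
  refine key _ _ _ (by positivity) (by positivity) ?_
  refine key _ _ _ (by positivity) (by positivity) ?_
  exact key _ _ _ (by positivity) (by positivity) le_rfl

theorem summable_norm_mk {x : ℕ → H} {p : ℕ → X} {q : ℕ → Y} {z y v : ℕ → G}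
    (hx : Summable fun n => ‖x n‖) (hp : Summable fun n => ‖p n‖)
    (hq : Summable fun n => ‖q n‖) (hz : Summable fun n => ‖z n‖)
    (hy : Summable fun n => ‖y n‖) (hv : Summable fun n => ‖v n‖) :
    Summable fun n => ‖mk (x n) (p n) (q n) (z n) (y n) (v n)‖ :=
  (hx.add (hp.add (hq.add (hz.add (hy.add hv))))).of_nonneg_of_le (fun _ => norm_nonneg _)
    fun _ => norm_mk_le _ _ _ _ _ _

end Normed

section Inner

variable [NormedAddCommGroup H] [InnerProductSpace ℝ H]
  [NormedAddCommGroup X] [InnerProductSpace ℝ X] [NormedAddCommGroup Y] [InnerProductSpace ℝ Y]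
  [NormedAddCommGroup G] [InnerProductSpace ℝ G]

theorem inner_mk (x x' : H) (p p' : X) (q q' : Y) (z y v z' y' v' : G) :
    ⟪mk x p q z y v, mk x' p' q' z' y' v'⟫ =
      ⟪x, x'⟫ + (⟪p, p'⟫ + (⟪q, q'⟫ + (⟪z, z'⟫ + (⟪y, y'⟫ + ⟪v, v'⟫)))) := by
  simp only [mk, WithLp.prod_inner_apply]

theorem smul_mk (c : ℝ) (x : H) (p : X) (q : Y) (z y v : G) :
    c • mk x p q z y v = mk (c • x) (c • p) (c • q) (c • z) (c • y) (c • v) := rfl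

end Inner

end Tuple

/-- The part of the primal-dual operator evaluated by resolvents. -/
def bwdOp {H X Y G : Type*} [Add H] [AddGroup G] (A : H → Set H) (B : X → Set X) (D : Y → Set Y) (w : H) (r : G) :
    Tuple H X Y G → Set (Tuple H X Y G) := fun a =>
  {u | u.fst + w ∈ A a.fst ∧ u.snd.fst ∈ B a.snd.fst ∧ u.snd.snd.fst ∈ D a.snd.snd.fst ∧
    u.snd.snd.snd.fst = -a.snd.snd.snd.snd.snd ∧
    u.snd.snd.snd.snd.fst = -a.snd.snd.snd.snd.snd ∧
    u.snd.snd.snd.snd.snd = r + a.snd.snd.snd.fst + a.snd.snd.snd.snd.fst}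

theorem mem_bwdOp {H X Y G : Type*} [Add H] [AddGroup G] {A : H → Set H} {B : X → Set X} {D : Y → Set Y} {w : H} {r : G}
    {x x' : H} {p p' : X} {q q' : Y} {z y v z' y' v' : G} :
    Tuple.mk x' p' q' z' y' v' ∈ bwdOp A B D w r (Tuple.mk x p q z y v) ↔
      x' + w ∈ A x ∧ p' ∈ B p ∧ q' ∈ D q ∧ z' = -v ∧ y' = -v ∧ v' = r + z + y := Iff.rfl

variable {H X Y G : Type*} [NormedAddCommGroup H] [InnerProductSpace ℝ H]
  [NormedAddCommGroup X] [InnerProductSpace ℝ X] [NormedAddCommGroup Y] [InnerProductSpace ℝ Y]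
  [NormedAddCommGroup G] [InnerProductSpace ℝ G]

open Tuple

/-- The part of the primal-dual operator evaluated by forward steps. -/
def fwdOp (C : H → H) (L : H →ₗ[ℝ] G) (L' : G →ₗ[ℝ] H) (K : G →ₗ[ℝ] X) (K' : X →ₗ[ℝ] G)
    (N : G →ₗ[ℝ] Y) (N' : Y →ₗ[ℝ] G) : Tuple H X Y G → Tuple H X Y G := fun a =>
  mk (C a.fst + L' a.snd.snd.snd.snd.snd) (-K a.snd.snd.snd.fst) (-N a.snd.snd.snd.snd.fst)
    (K' a.snd.fst) (N' a.snd.snd.fst) (-L a.fst)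

theorem fwdOp_mk (C : H → H) (L : H →ₗ[ℝ] G) (L' : G →ₗ[ℝ] H) (K : G →ₗ[ℝ] X)
    (K' : X →ₗ[ℝ] G) (N : G →ₗ[ℝ] Y) (N' : Y →ₗ[ℝ] G) (x : H) (p : X) (q : Y) (z y v : G) :
    fwdOp C L L' K K' N N' (mk x p q z y v) =
      mk (C x + L' v) (-K z) (-N y) (K' p) (N' q) (-L x) := rfl

theorem monoOp_bwdOp {A : H → Set H} (hA : MonoOp A) {B : X → Set X} (hB : MonoOp B)
    {D : Y → Set Y} (hD : MonoOp D) (w : H) (r : G) : MonoOp (bwdOp A B D w r) := by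
  intro a b u u' hu hu'
  obtain ⟨x, p, q, z, y, v, rfl⟩ := exists_mk a
  obtain ⟨x', p', q', z', y', v', rfl⟩ := exists_mk b
  obtain ⟨ux, up, uq, uz, uy, uv, rfl⟩ := exists_mk u
  obtain ⟨ux', up', uq', uz', uy', uv', rfl⟩ := exists_mk u'
  rw [mem_bwdOp] at hu hu'
  obtain ⟨h1, h2, h3, rfl, rfl, rfl⟩ := hu
  obtain ⟨k1, k2, k3, rfl, rfl, rfl⟩ := hu'
  rw [mk_sub, mk_sub, inner_mk]
  have e1 := hA h1 k1
  rw [add_sub_add_right_eq_sub] at e1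
  have e2 := hB h2 k2
  have e3 := hD h3 k3
  have e4 : ⟪z - z', -v - -v'⟫ + (⟪y - y', -v - -v'⟫ +
      ⟪v - v', r + z + y - (r + z' + y')⟫) = 0 := by
    rw [show r + z + y - (r + z' + y') = (z - z') + (y - y') by abel,
      show -v - -v' = -(v - v') by abel, inner_neg_right, inner_neg_right, inner_add_right,
      real_inner_comm (z - z'), real_inner_comm (y - y')]
    ring
  rw [e4]
  linarith

theorem exists_isRes_bwdOp {A : H → Set H} {B : X → Set X} {D : Y → Set Y} {γ : ℝ}
    (hA : ∀ w, ∃ x, IsRes γ A w x) (hB : ∀ w, ∃ x, IsRes γ B w x)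
    (hD : ∀ w, ∃ x, IsRes γ D w x) (w : H) (r : G) (a : Tuple H X Y G) :
    ∃ b, IsRes γ (bwdOp A B D w r) a b := by
  obtain ⟨x, p, q, z, y, v, rfl⟩ := exists_mk a
  obtain ⟨x', ux, hx, ex⟩ := hA (x + γ • w)
  obtain ⟨p', up, hp, ep⟩ := hB p
  obtain ⟨q', uq, hq, eq⟩ := hD q
  have hc : (1 + 2 * γ ^ 2) ≠ 0 := by positivity
  set v' : G := (1 + 2 * γ ^ 2)⁻¹ • (v - γ • r - γ • (z + y)) with hv'
  have hv : (1 + 2 * γ ^ 2) • v' = v - γ • r - γ • (z + y) := by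
    rw [hv', smul_inv_smul₀ hc]
  refine ⟨mk x' p' q' (z + γ • v') (y + γ • v') v',
    mk (ux - w) up uq (-v') (-v') (r + (z + γ • v') + (y + γ • v')), ?_, ?_⟩
  · rw [mem_bwdOp]
    exact ⟨by simpa using hx, hp, hq, rfl, rfl, rfl⟩
  · simp only at ex ep eq ⊢
    rw [mk_sub, smul_mk, mk_inj]
    refine ⟨?_, ep, eq, by module, by module, ?_⟩
    · rw [smul_sub, ex]
      abel
    · rw [show v = (1 + 2 * γ ^ 2) • v' + γ • r + γ • (z + y) by rw [hv]; abel]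
      module

theorem inner_fwdOp_nonneg {C : H → H} (hC : ∀ x y, (0:ℝ) ≤ ⟪x - y, C x - C y⟫)
    {L : H →ₗ[ℝ] G} {L' : G →ₗ[ℝ] H} (hL : ∀ x v, ⟪L x, v⟫ = ⟪x, L' v⟫)
    {K : G →ₗ[ℝ] X} {K' : X →ₗ[ℝ] G} (hK : ∀ x v, ⟪K x, v⟫ = ⟪x, K' v⟫)
    {N : G →ₗ[ℝ] Y} {N' : Y →ₗ[ℝ] G} (hN : ∀ x v, ⟪N x, v⟫ = ⟪x, N' v⟫)
    (a b : Tuple H X Y G) :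
    (0:ℝ) ≤ ⟪a - b, fwdOp C L L' K K' N N' a - fwdOp C L L' K K' N N' b⟫ := by
  obtain ⟨x, p, q, z, y, v, rfl⟩ := exists_mk a
  obtain ⟨x', p', q', z', y', v', rfl⟩ := exists_mk b
  rw [fwdOp_mk, fwdOp_mk, mk_sub, mk_sub, inner_mk]
  rw [show C x + L' v - (C x' + L' v') = (C x - C x') + L' (v - v') by rw [map_sub]; abel,
    show -K z - -K z' = -K (z - z') by rw [map_sub]; abel,
    show -N y - -N y' = -N (y - y') by rw [map_sub]; abel,
    show -L x - -L x' = -L (x - x') by rw [map_sub]; abel, ← map_sub, ← map_sub,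
    inner_add_right, inner_neg_right, inner_neg_right, inner_neg_right, ← hL, ← hK, ← hN,
    real_inner_comm (L _), real_inner_comm (K _), real_inner_comm (N _)]
  linarith [hC x x']

theorem norm_fwdOp_sub_le {C : H → H} {μ : ℝ} (hμ : 0 ≤ μ)
    (hC : ∀ x y, ‖C x - C y‖ ≤ μ * ‖x - y‖) {s : ℝ} (hs : 0 ≤ s)
    {L : H →ₗ[ℝ] G} {L' : G →ₗ[ℝ] H} (hL : ∀ x, ‖L x‖ ^ 2 ≤ s * ‖x‖ ^ 2)
    (hL' : ∀ x, ‖L' x‖ ^ 2 ≤ s * ‖x‖ ^ 2)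
    {K : G →ₗ[ℝ] X} {K' : X →ₗ[ℝ] G} (hK : ∀ x, ‖K x‖ ^ 2 ≤ s * ‖x‖ ^ 2)
    (hK' : ∀ x, ‖K' x‖ ^ 2 ≤ s * ‖x‖ ^ 2)
    {N : G →ₗ[ℝ] Y} {N' : Y →ₗ[ℝ] G} (hN : ∀ x, ‖N x‖ ^ 2 ≤ s * ‖x‖ ^ 2)
    (hN' : ∀ x, ‖N' x‖ ^ 2 ≤ s * ‖x‖ ^ 2) (a b : Tuple H X Y G) :
    ‖fwdOp C L L' K K' N N' a - fwdOp C L L' K K' N N' b‖ ≤ (μ + √s) * ‖a - b‖ := by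
  obtain ⟨x, p, q, z, y, v, rfl⟩ := exists_mk a
  obtain ⟨x', p', q', z', y', v', rfl⟩ := exists_mk b
  have e : fwdOp C L L' K K' N N' (mk x p q z y v) - fwdOp C L L' K K' N N' (mk x' p' q' z' y' v')
      = mk (C x - C x') 0 0 0 0 0 + mk (L' (v - v')) (-K (z - z')) (-N (y - y')) (K' (p - p'))
        (N' (q - q')) (-L (x - x')) := by
    rw [fwdOp_mk, fwdOp_mk, mk_sub, mk_add, mk_inj]
    simp only [map_sub]
    refine ⟨?_, ?_, ?_, ?_, ?_, ?_⟩ <;> abel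
  rw [e, mk_sub, add_mul]
  refine (norm_add_le _ _).trans (add_le_add ?_ ?_)
  · refine (sq_le_sq₀ (norm_nonneg _) (by positivity)).1 ?_
    rw [mul_pow, norm_sq_mk, norm_sq_mk]
    have h1 : ‖C x - C x'‖ ^ 2 ≤ (μ * ‖x - x'‖) ^ 2 := by gcongr; exact hC x x'
    have h2 : 0 ≤ μ ^ 2 * (‖p - p'‖ ^ 2 + (‖q - q'‖ ^ 2 + (‖z - z'‖ ^ 2 +
      (‖y - y'‖ ^ 2 + ‖v - v'‖ ^ 2)))) := by positivity
    simp only [norm_zero]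
    linarith
  · refine (sq_le_sq₀ (norm_nonneg _) (by positivity)).1 ?_
    rw [mul_pow, Real.sq_sqrt hs, norm_sq_mk, norm_sq_mk, norm_neg, norm_neg, norm_neg]
    linarith [hL (x - x'), hL' (v - v'), hK (z - z'), hK' (p - p'), hN (y - y'), hN' (q - q')]

theorem bwd_coupled_solve {G : Type*} [AddCommGroup G] [Module ℝ G] (c : ℝ) {u₁ u₂ z y : G}
    (hz : z = ((1 + c ^ 2) / (1 + 2 * c ^ 2)) • (u₁ - (c ^ 2 / (1 + c ^ 2)) • u₂))
    (hy : y = (1 / (1 + c ^ 2)) • (u₂ - c ^ 2 • z)) :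
    z + c ^ 2 • (z + y) = u₁ ∧ y + c ^ 2 • (z + y) = u₂ := by
  have h1 : 1 + c ^ 2 ≠ 0 := by positivity
  have h2 : 1 + 2 * c ^ 2 ≠ 0 := by positivity
  subst hy hz
  constructor <;> match_scalars <;> field_simp <;> ring

theorem Summable.norm_smul_of_bounded {E : Type*} [NormedAddCommGroup E] [NormedSpace ℝ E]
    {f : ℕ → E} (hf : Summable fun n => ‖f n‖) {c : ℕ → ℝ} {R : ℝ} (hc : ∀ n, |c n| ≤ R) :
    Summable fun n => ‖c n • f n‖ := by
  refine (hf.mul_left R).of_nonneg_of_le (fun _ => norm_nonneg _) fun n => ?_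
  rw [norm_smul, Real.norm_eq_abs]
  exact mul_le_mul_of_nonneg_right (hc n) (norm_nonneg _)

theorem Summable.norm_add {E : Type*} [NormedAddCommGroup E]
    {f g : ℕ → E} (hf : Summable fun n => ‖f n‖) (hg : Summable fun n => ‖g n‖) :
    Summable fun n => ‖f n + g n‖ :=
  (hf.add hg).of_nonneg_of_le (fun _ => norm_nonneg _) fun _ => norm_add_le _ _

/-- The inexact primal-dual method for a single parallel sum, with bounded linear operators
represented by adjoint pairs `(L, L')`, `(K, K')`, `(N, N')`, and `B`, `D` standing for the
inverses of the operators entering the parallel sum. -/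
theorem exists_wConv_primal_dual [CompleteSpace H] [CompleteSpace X] [CompleteSpace Y]
    [CompleteSpace G] (w : H) {A : H → Set H} (hA : MonoOp A)
    (hAres : ∀ γ : ℝ, 0 < γ → ∀ w, ∃ x, IsRes γ A w x)
    {μ : ℝ} (hμ : 0 < μ) {C : H → H} (hC : ∀ x y, (0:ℝ) ≤ ⟪x - y, C x - C y⟫)
    (hClip : ∀ x y, ‖C x - C y‖ ≤ μ * ‖x - y‖) (r : G)
    {B : X → Set X} (hB : MonoOp B) (hBres : ∀ γ : ℝ, 0 < γ → ∀ w, ∃ x, IsRes γ B w x)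
    {D : Y → Set Y} (hD : MonoOp D) (hDres : ∀ γ : ℝ, 0 < γ → ∀ w, ∃ x, IsRes γ D w x)
    {L : H →ₗ[ℝ] G} {L' : G →ₗ[ℝ] H} (hLL' : ∀ x v, ⟪L x, v⟫ = ⟪x, L' v⟫)
    {K : G →ₗ[ℝ] X} {K' : X →ₗ[ℝ] G} (hKK' : ∀ x v, ⟪K x, v⟫ = ⟪x, K' v⟫)
    {N : G →ₗ[ℝ] Y} {N' : Y →ₗ[ℝ] G} (hNN' : ∀ x v, ⟪N x, v⟫ = ⟪x, N' v⟫)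
    {s : ℝ} (hs : 0 ≤ s) (hL : ∀ x, ‖L x‖ ^ 2 ≤ s * ‖x‖ ^ 2)
    (hK : ∀ x, ‖K x‖ ^ 2 ≤ s * ‖x‖ ^ 2) (hN : ∀ x, ‖N x‖ ^ 2 ≤ s * ‖x‖ ^ 2)
    {β : ℝ} (hβ : β = μ + √s)
    (hsol : ∃ x p q z y, w - L' (K' p) - C x ∈ A x ∧ K z ∈ B p ∧ N y ∈ D q ∧ K' p = N' q ∧
      L x - r = z + y)
    {ε : ℝ} (hε : ε ∈ Set.Ioo (0:ℝ) (1 / (β + 1)))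
    {γ : ℕ → ℝ} (hγ : ∀ n, γ n ∈ Set.Icc ε ((1 - ε) / β))
    {x xt jx : ℕ → H} {p pt jp : ℕ → X} {q qt jq : ℕ → Y} {z zt y yt v vt u₁ u₂ : ℕ → G}
    (hjx : ∀ n, IsRes (γ n) A (x n - γ n • (C (x n) + L' (v n) - w)) (jx n))
    (hxt : Summable fun n => ‖xt n - jx n‖)
    (hjp : ∀ n, IsRes (γ n) B (p n + γ n • K (z n)) (jp n))
    (hpt : Summable fun n => ‖pt n - jp n‖)
    (hjq : ∀ n, IsRes (γ n) D (q n + γ n • N (y n)) (jq n))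
    (hqt : Summable fun n => ‖qt n - jq n‖)
    (hu₁ : Summable fun n =>
      ‖u₁ n - (z n - γ n • (K' (p n) - v n - γ n • (L (x n) - r)))‖)
    (hu₂ : Summable fun n =>
      ‖u₂ n - (y n - γ n • (N' (q n) - v n - γ n • (L (x n) - r)))‖)
    (hzt : Summable fun n => ‖zt n - ((1 + γ n ^ 2) / (1 + 2 * γ n ^ 2)) •
      (u₁ n - (γ n ^ 2 / (1 + γ n ^ 2)) • u₂ n)‖)
    (hyt : Summable fun n => ‖yt n - (1 / (1 + γ n ^ 2)) • (u₂ n - γ n ^ 2 • zt n)‖)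
    (hvt : Summable fun n => ‖vt n - (v n + γ n • (L (x n) - r - zt n - yt n))‖)
    (hx : Summable fun n =>
      ‖x (n + 1) - (xt n + γ n • (C (x n) - C (xt n) + L' (v n - vt n)))‖)
    (hp : Summable fun n => ‖p (n + 1) - (pt n - γ n • K (z n - zt n))‖)
    (hq : Summable fun n => ‖q (n + 1) - (qt n - γ n • N (y n - yt n))‖)
    (hz : Summable fun n => ‖z (n + 1) - (zt n + γ n • K' (p n - pt n))‖)
    (hy : Summable fun n => ‖y (n + 1) - (yt n + γ n • N' (q n - qt n))‖)
    (hv : Summable fun n => ‖v (n + 1) - (vt n - γ n • L (x n - xt n))‖) :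
    ∃ xb pb qb yb, w - L' (K' pb) - C xb ∈ A xb ∧ K (L xb - yb - r) ∈ B pb ∧ N yb ∈ D qb ∧
      K' pb = N' qb ∧ WConv x xb ∧ WConv xt xb ∧ WConv p pb ∧ WConv pt pb ∧
      WConv q qb ∧ WConv qt qb ∧ WConv y yb ∧ WConv yt yb := by
  have hβ0 : 0 < β := by rw [hβ]; positivity
  have hε0 : 0 < ε := hε.1
  have hγ0 : ∀ n, 0 < γ n := fun n => hε0.trans_le (hγ n).1
  have hγR : ∀ n, |-γ n| ≤ (1 - ε) / β := fun n => by
    rw [abs_neg, abs_of_pos (hγ0 n)]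
    exact (hγ n).2
  set U₁ : ℕ → G := fun n => z n - γ n • (K' (p n) - v n - γ n • (L (x n) - r)) with hU₁
  set U₂ : ℕ → G := fun n => y n - γ n • (N' (q n) - v n - γ n • (L (x n) - r)) with hU₂
  set jz : ℕ → G := fun n => ((1 + γ n ^ 2) / (1 + 2 * γ n ^ 2)) •
      (U₁ n - (γ n ^ 2 / (1 + γ n ^ 2)) • U₂ n) with hjz
  set jy : ℕ → G := fun n => (1 / (1 + γ n ^ 2)) • (U₂ n - γ n ^ 2 • jz n) with hjy
  set jv : ℕ → G := fun n => v n + γ n • (L (x n) - r - jz n - jy n) with hjv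
  have ezt : Summable fun n => ‖zt n - jz n‖ := by
    have h1 := hu₁.norm_smul_of_bounded
      (c := fun n => (1 + γ n ^ 2) / (1 + 2 * γ n ^ 2)) (R := 1) fun n => by
        rw [abs_of_nonneg (by positivity), div_le_one (by positivity)]
        nlinarith [sq_nonneg (γ n)]
    have h2 := hu₂.norm_smul_of_bounded
      (c := fun n => -((1 + γ n ^ 2) / (1 + 2 * γ n ^ 2) * (γ n ^ 2 / (1 + γ n ^ 2))))
      (R := 1) fun n => by
        rw [abs_neg, abs_of_nonneg (by positivity)]
        refine mul_le_one₀ ?_ (by positivity) ?_ <;> rw [div_le_one (by positivity)] <;>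
          nlinarith [sq_nonneg (γ n)]
    refine ((hzt.norm_add h1).norm_add h2).congr fun n => ?_
    congr 1
    simp only [hjz]
    module
  have eyt : Summable fun n => ‖yt n - jy n‖ := by
    have h1 := hu₂.norm_smul_of_bounded (c := fun n => 1 / (1 + γ n ^ 2)) (R := 1) fun n => by
        rw [abs_of_nonneg (by positivity), div_le_one (by positivity)]
        nlinarith [sq_nonneg (γ n)]
    have h2 := ezt.norm_smul_of_bounded
      (c := fun n => -(1 / (1 + γ n ^ 2) * γ n ^ 2)) (R := 1) fun n => by
        rw [abs_neg, abs_of_nonneg (by positivity), one_div_mul_eq_div,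
          div_le_one (by positivity)]
        nlinarith [sq_nonneg (γ n)]
    refine ((hyt.norm_add h1).norm_add h2).congr fun n => ?_
    congr 1
    simp only [hjy]
    module
  have evt : Summable fun n => ‖vt n - jv n‖ := by
    refine ((hvt.norm_add (ezt.norm_smul_of_bounded hγR)).norm_add
      (eyt.norm_smul_of_bounded hγR)).congr fun n => ?_
    congr 1
    simp only [hjv]
    module
  have hj : ∀ n, IsRes (γ n) (bwdOp A B D w r)
      (mk (x n) (p n) (q n) (z n) (y n) (v n) -
        γ n • fwdOp C L L' K K' N N' (mk (x n) (p n) (q n) (z n) (y n) (v n)))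
      (mk (jx n) (jp n) (jq n) (jz n) (jy n) (jv n)) := by
    intro n
    obtain ⟨ux, hux, ex⟩ := hjx n
    obtain ⟨up, hup, ep⟩ := hjp n
    obtain ⟨uq, huq, eq⟩ := hjq n
    obtain ⟨e1, e2⟩ := bwd_coupled_solve (γ n) (z := jz n) (y := jy n) rfl rfl
    refine ⟨mk (ux - w) up uq (-jv n) (-jv n) (r + jz n + jy n), ?_, ?_⟩
    · rw [mem_bwdOp]
      exact ⟨by simpa using hux, hup, huq, rfl, rfl, rfl⟩
    · simp only at ex ep eq ⊢
      rw [fwdOp_mk, smul_mk, smul_mk, mk_sub, mk_sub, mk_inj]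
      refine ⟨?_, ?_, ?_, ?_, ?_, ?_⟩
      · rw [smul_sub, ex]
        module
      · rw [ep]
        module
      · rw [eq]
        module
      · have : z n = jz n + γ n ^ 2 • (jz n + jy n) +
            γ n • (K' (p n) - v n - γ n • (L (x n) - r)) := by
          rw [e1]
          simp only [hU₁]
          abel
        simp only [hjv]
        rw [this]
        module
      · have : y n = jy n + γ n ^ 2 • (jz n + jy n) +
            γ n • (N' (q n) - v n - γ n • (L (x n) - r)) := by
          rw [e2]
          simp only [hU₂]
          abel
        simp only [hjv]
        rw [this]
        module
      · simp only [hjv]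
        module
  obtain ⟨l, hl, hconv, hconvt⟩ := exists_wConv_fbf (monoOp_bwdOp hA hB hD w r)
    (fun c hc => exists_isRes_bwdOp (hAres c hc) (hBres c hc) (hDres c hc) w r)
    (inner_fwdOp_nonneg hC hLL' hKK' hNN') hβ0
    (by
      rw [hβ]
      exact norm_fwdOp_sub_le hμ.le hClip hs hL (norm_sq_le_of_adjoint hLL' hs hL)
        hK (norm_sq_le_of_adjoint hKK' hs hK) hN (norm_sq_le_of_adjoint hNN' hs hN))
    (by
      obtain ⟨x, p, q, z, y, h1, h2, h3, h4, h5⟩ := hsol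
      refine ⟨mk x p q z y (K' p), ?_⟩
      rw [fwdOp_mk, show -mk (C x + L' (K' p)) (-K z) (-N y) (K' p) (N' q) (-L x) =
        mk (-(C x + L' (K' p))) (- -K z) (- -N y) (-K' p) (-N' q) (- -L x) from rfl, mem_bwdOp]
      refine ⟨?_, by simpa using h2, by simpa using h3, rfl, by rw [h4], ?_⟩
      · convert h1 using 1
        abel
      · rw [neg_neg, add_assoc, ← h5]
        abel)
    hε hγ hj (xt := fun n => mk (xt n) (pt n) (qt n) (zt n) (yt n) (vt n))
    (by
      simp only [mk_sub]
      exact summable_norm_mk hxt hpt hqt ezt eyt evt)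
    (by
      simp only [fwdOp_mk, mk_sub, smul_mk, mk_add]
      refine summable_norm_mk (hx.congr fun n => ?_) (hp.congr fun n => ?_)
        (hq.congr fun n => ?_) (hz.congr fun n => ?_) (hy.congr fun n => ?_)
        (hv.congr fun n => ?_) <;> congr 2 <;> rw [map_sub] <;> module)
  obtain ⟨xb, pb, qb, zb, yb, vb, rfl⟩ := exists_mk l
  rw [fwdOp_mk, show -mk (C xb + L' vb) (-K zb) (-N yb) (K' pb) (N' qb) (-L xb) =
    mk (-(C xb + L' vb)) (- -K zb) (- -N yb) (-K' pb) (-N' qb) (- -L xb) from rfl,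
    mem_bwdOp] at hl
  obtain ⟨h1, h2, h3, h4, h5, h6⟩ := hl
  simp only [neg_neg, neg_inj] at h2 h3 h4 h5 h6
  refine ⟨xb, pb, qb, yb, ?_, ?_, h3, h4.trans h5.symm, hconv.fst, hconvt.fst, hconv.snd.fst,
    hconvt.snd.fst, hconv.snd.snd.fst, hconvt.snd.snd.fst, hconv.snd.snd.snd.snd.fst,
    hconvt.snd.snd.snd.snd.fst⟩
  · rw [h4]
    convert h1 using 1
    abel
  · rw [h6, show r + zb + yb - yb - r = zb by abel]
    exact h2

end Block

section Family

variable {ι : Type*}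
  {F : ι → Type*} [∀ i, NormedAddCommGroup (F i)] [∀ i, InnerProductSpace ℝ (F i)]
  {F' : ι → Type*} [∀ i, NormedAddCommGroup (F' i)] [∀ i, InnerProductSpace ℝ (F' i)]
  {H : Type*} [NormedAddCommGroup H] [InnerProductSpace ℝ H]

/-- The product of a family of set-valued operators. -/
def piOp (B : ∀ i, F i → Set (F i)) : PiLp 2 F → Set (PiLp 2 F) :=
  fun p => {u | ∀ i, u i ∈ B i (p i)}

theorem isRes_piOp {B : ∀ i, F i → Set (F i)} {γ : ℝ} {w x : PiLp 2 F}
    (h : ∀ i, IsRes γ (B i) (w i) (x i)) : IsRes γ (piOp B) w x := by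
  choose u hu hux using h
  refine ⟨WithLp.toLp 2 u, hu, ?_⟩
  ext i
  exact hux i

theorem exists_isRes_piOp {B : ∀ i, F i → Set (F i)} {γ : ℝ}
    (h : ∀ i w, ∃ x, IsRes γ (B i) w x) (w : PiLp 2 F) : ∃ x, IsRes γ (piOp B) w x := by
  choose x hx using fun i => h i (w i)
  exact ⟨WithLp.toLp 2 x, isRes_piOp hx⟩

theorem monoOp_piOp [Fintype ι] {B : ∀ i, F i → Set (F i)} (hB : ∀ i, MonoOp (B i)) : MonoOp (piOp B) := by
  intro x y u v hu hv
  rw [PiLp.inner_apply]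
  exact Finset.sum_nonneg fun i _ => hB i (hu i) (hv i)

def piLinear (L : ∀ i, H →L[ℝ] F i) : H →ₗ[ℝ] PiLp 2 F where
  toFun x := WithLp.toLp 2 fun i => L i x
  map_add' x y := by ext i; simp
  map_smul' c x := by ext i; simp

def sumLinear [Fintype ι] (T : ∀ i, F i →L[ℝ] H) : PiLp 2 F →ₗ[ℝ] H where
  toFun v := ∑ i, T i (v i)
  map_add' x y := by simp [Finset.sum_add_distrib]
  map_smul' c x := by simp [Finset.smul_sum]

def diagLinear (K : ∀ i, F i →L[ℝ] F' i) : PiLp 2 F →ₗ[ℝ] PiLp 2 F' where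
  toFun x := WithLp.toLp 2 fun i => K i (x i)
  map_add' x y := by ext i; simp
  map_smul' c x := by ext i; simp

theorem inner_piLinear [Fintype ι] [CompleteSpace H] [∀ i, CompleteSpace (F i)]
    (L : ∀ i, H →L[ℝ] F i) (x : H) (v : PiLp 2 F) :
    ⟪piLinear L x, v⟫ = ⟪x, sumLinear (fun i => ContinuousLinearMap.adjoint (L i)) v⟫ := by
  rw [PiLp.inner_apply]
  simp only [sumLinear, LinearMap.coe_mk, AddHom.coe_mk, inner_sum,
    ContinuousLinearMap.adjoint_inner_right]
  rfl

theorem inner_diagLinear [Fintype ι] [∀ i, CompleteSpace (F i)] [∀ i, CompleteSpace (F' i)]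
    (K : ∀ i, F i →L[ℝ] F' i) (x : PiLp 2 F) (v : PiLp 2 F') :
    ⟪diagLinear K x, v⟫ = ⟪x, diagLinear (fun i => ContinuousLinearMap.adjoint (K i)) v⟫ := by
  rw [PiLp.inner_apply, PiLp.inner_apply]
  simp only [diagLinear, LinearMap.coe_mk, AddHom.coe_mk, ContinuousLinearMap.adjoint_inner_right]

theorem norm_piLinear_sq_le [Fintype ι] (L : ∀ i, H →L[ℝ] F i) (x : H) :
    ‖piLinear L x‖ ^ 2 ≤ (∑ i, ‖L i‖ ^ 2) * ‖x‖ ^ 2 := by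
  rw [PiLp.norm_sq_eq_of_L2, Finset.sum_mul]
  refine Finset.sum_le_sum fun i _ => ?_
  rw [← mul_pow]
  exact pow_le_pow_left₀ (norm_nonneg _) ((L i).le_opNorm x) 2

theorem norm_diagLinear_sq_le [Fintype ι] (K : ∀ i, F i →L[ℝ] F' i) {s : ℝ} (hs : ∀ i, ‖K i‖ ^ 2 ≤ s)
    (x : PiLp 2 F) : ‖diagLinear K x‖ ^ 2 ≤ s * ‖x‖ ^ 2 := by
  rw [PiLp.norm_sq_eq_of_L2, PiLp.norm_sq_eq_of_L2, Finset.mul_sum]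
  refine Finset.sum_le_sum fun i _ => ?_
  calc ‖K i (x i)‖ ^ 2 ≤ (‖K i‖ * ‖x i‖) ^ 2 :=
        pow_le_pow_left₀ (norm_nonneg _) ((K i).le_opNorm _) 2
    _ = ‖K i‖ ^ 2 * ‖x i‖ ^ 2 := mul_pow _ _ _
    _ ≤ _ := mul_le_mul_of_nonneg_right (hs i) (sq_nonneg _)

end Family

theorem stmt3 {m : ℕ}
    {H : Type*} [NormedAddCommGroup H] [InnerProductSpace ℝ H] [CompleteSpace H]
    {G : Fin m → Type*} [∀ i, NormedAddCommGroup (G i)] [∀ i, InnerProductSpace ℝ (G i)]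
    [∀ i, CompleteSpace (G i)]
    {X : Fin m → Type*} [∀ i, NormedAddCommGroup (X i)] [∀ i, InnerProductSpace ℝ (X i)]
    [∀ i, CompleteSpace (X i)]
    {Y : Fin m → Type*} [∀ i, NormedAddCommGroup (Y i)] [∀ i, InnerProductSpace ℝ (Y i)]
    [∀ i, CompleteSpace (Y i)]
    (z : H) (A : H → Set H) (hA : MaxMonoOp A)
    (μ : ℝ) (hμ : 0 < μ) (C : H → H)
    (hCmono : ∀ x y : H, (0:ℝ) ≤ ⟪x - y, C x - C y⟫)
    (r : ∀ i, G i)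
    (B : ∀ i, X i → Set (X i)) (hB : ∀ i, MaxMonoOp (B i))
    (D : ∀ i, Y i → Set (Y i)) (hD : ∀ i, MaxMonoOp (D i))
    (L : ∀ i, H →L[ℝ] G i) (hL : ∀ i, L i ≠ 0)
    (K : ∀ i, G i →L[ℝ] X i) (hK : ∀ i, K i ≠ 0)
    (M : ∀ i, G i →L[ℝ] Y i) (hM : ∀ i, M i ≠ 0)
    -- C is μ-Lipschitz continuous
    (hClip : ∀ x y : H, ‖C x - C y‖ ≤ μ * ‖x - y‖)
    -- range condition
    (hran : ∃ (x : H) (u : H) (w : ∀ i, G i), u ∈ A x ∧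
        (∀ i, w i ∈ parOp (compOp (K i) (B i)) (compOp (M i) (D i)) (L i x - r i)) ∧
        z = u + ∑ i, ContinuousLinearMap.adjoint (L i) (w i) + C x)
    -- the constant β
    (β : ℝ)
    (hβ : ∃ s : ℝ, IsGreatest ({∑ i, ‖L i‖ ^ 2} ∪ Set.range (fun j => ‖K j‖ ^ 2) ∪
        Set.range (fun j => ‖M j‖ ^ 2)) s ∧ β = μ + Real.sqrt s)
    -- step sizes
    (ε : ℝ) (hε : ε ∈ Set.Ioo (0:ℝ) (1 / (β + 1)))
    (γ : ℕ → ℝ) (hγ : ∀ n, γ n ∈ Set.Icc ε ((1 - ε) / β))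
    -- the sequences generated by Algorithm 3.4
    (x xt : ℕ → H)
    (p pt : ℕ → ∀ i, X i) (q qt : ℕ → ∀ i, Y i)
    (zz zt y yt v vt u1 u2 : ℕ → ∀ i, G i)
    (hxt : ∃ j : ℕ → H,
      (∀ n, IsRes (γ n) A
        (x n - γ n • (C (x n) + ∑ i, ContinuousLinearMap.adjoint (L i) (v n i) - z)) (j n)) ∧
      Summable (fun n => ‖xt n - j n‖))
    (hpt : ∀ i, ∃ j : ℕ → X i,
      (∀ n, IsRes (γ n) (invOp (B i)) (p n i + γ n • K i (zz n i)) (j n)) ∧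
      Summable (fun n => ‖pt n i - j n‖))
    (hqt : ∀ i, ∃ j : ℕ → Y i,
      (∀ n, IsRes (γ n) (invOp (D i)) (q n i + γ n • M i (y n i)) (j n)) ∧
      Summable (fun n => ‖qt n i - j n‖))
    (hu1 : ∀ i, Summable (fun n => ‖u1 n i - (zz n i - γ n •
        (ContinuousLinearMap.adjoint (K i) (p n i) - v n i - γ n • (L i (x n) - r i)))‖))
    (hu2 : ∀ i, Summable (fun n => ‖u2 n i - (y n i - γ n •
        (ContinuousLinearMap.adjoint (M i) (q n i) - v n i - γ n • (L i (x n) - r i)))‖))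
    (hzt : ∀ i, Summable (fun n => ‖zt n i -
        ((1 + γ n ^ 2) / (1 + 2 * γ n ^ 2)) •
          (u1 n i - (γ n ^ 2 / (1 + γ n ^ 2)) • u2 n i)‖))
    (hyt : ∀ i, Summable (fun n => ‖yt n i -
        (1 / (1 + γ n ^ 2)) • (u2 n i - γ n ^ 2 • zt n i)‖))
    (hvt : ∀ i, Summable (fun n => ‖vt n i -
        (v n i + γ n • (L i (x n) - r i - zt n i - yt n i))‖))
    (hx : Summable (fun n => ‖x (n+1) - (xt n + γ n • (C (x n) - C (xt n) +
        ∑ i, ContinuousLinearMap.adjoint (L i) (v n i - vt n i)))‖))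
    (hp : ∀ i, Summable (fun n => ‖p (n+1) i - (pt n i - γ n • K i (zz n i - zt n i))‖))
    (hq : ∀ i, Summable (fun n => ‖q (n+1) i - (qt n i - γ n • M i (y n i - yt n i))‖))
    (hz : ∀ i, Summable (fun n => ‖zz (n+1) i - (zt n i + γ n •
        ContinuousLinearMap.adjoint (K i) (p n i - pt n i))‖))
    (hy : ∀ i, Summable (fun n => ‖y (n+1) i - (yt n i + γ n •
        ContinuousLinearMap.adjoint (M i) (q n i - qt n i))‖))
    (hv : ∀ i, Summable (fun n => ‖v (n+1) i - (vt n i - γ n • L i (x n - xt n))‖))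
    :
    ∃ (xb : H) (pb : ∀ i, X i) (qb : ∀ i, Y i) (yb : ∀ i, G i),
      (z - ∑ i, ContinuousLinearMap.adjoint (L i)
          (ContinuousLinearMap.adjoint (K i) (pb i)) - C xb ∈ A xb) ∧
      (∀ i, K i (L i xb - yb i - r i) ∈ invOp (B i) (pb i)) ∧
      (∀ i, M i (yb i) ∈ invOp (D i) (qb i)) ∧
      (∀ i, ContinuousLinearMap.adjoint (K i) (pb i) =
          ContinuousLinearMap.adjoint (M i) (qb i)) ∧
      WConv x xb ∧ WConv xt xb ∧
      (∀ i, WConv (fun n => p n i) (pb i)) ∧ (∀ i, WConv (fun n => pt n i) (pb i)) ∧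
      (∀ i, WConv (fun n => q n i) (qb i)) ∧ (∀ i, WConv (fun n => qt n i) (qb i)) ∧
      (∀ i, WConv (fun n => y n i) (yb i)) ∧ (∀ i, WConv (fun n => yt n i) (yb i)) := by
  obtain ⟨s, ⟨-, hsup⟩, hβs⟩ := hβ
  have hsL : ∑ i, ‖L i‖ ^ 2 ≤ s := hsup (Or.inl (Or.inl rfl))
  have hsK : ∀ i, ‖K i‖ ^ 2 ≤ s := fun i => hsup (Or.inl (Or.inr ⟨i, rfl⟩))
  have hsM : ∀ i, ‖M i‖ ^ 2 ≤ s := fun i => hsup (Or.inr ⟨i, rfl⟩)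
  have hs : 0 ≤ s := (Finset.sum_nonneg fun i _ => sq_nonneg ‖L i‖).trans hsL
  obtain ⟨jx, hjx, hxt⟩ := hxt
  choose jp hjp hpt using hpt
  choose jq hjq hqt using hqt
  obtain ⟨x₀, u₀, w₀, hu₀, hw₀, hz₀⟩ := hran
  choose a ha b hb hab using hw₀
  choose p₀ hp₀ hpw using ha
  choose q₀ hq₀ hqw using hb
  obtain ⟨xb, pb, qb, yb, h1, h2, h3, h4, c1, c2, c3, c4, c5, c6, c7, c8⟩ :=
    exists_wConv_primal_dual (w := z) hA.1 (fun c hc => hA.exists_isRes hc) hμ hCmono hClip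
      (WithLp.toLp 2 r) (B := piOp fun i => invOp (B i)) (monoOp_piOp fun i => (hB i).invOp.1)
      (fun c hc => exists_isRes_piOp fun i => (hB i).invOp.exists_isRes hc)
      (D := piOp fun i => invOp (D i)) (monoOp_piOp fun i => (hD i).invOp.1)
      (fun c hc => exists_isRes_piOp fun i => (hD i).invOp.exists_isRes hc)
      (inner_piLinear L) (inner_diagLinear K) (inner_diagLinear M) hs
      (fun x => (norm_piLinear_sq_le L x).trans (mul_le_mul_of_nonneg_right hsL (sq_nonneg _)))
      (norm_diagLinear_sq_le K hsK) (norm_diagLinear_sq_le M hsM) hβs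
      (by
        refine ⟨x₀, WithLp.toLp 2 p₀, WithLp.toLp 2 q₀, WithLp.toLp 2 a, WithLp.toLp 2 b,
          ?_, hp₀, hq₀, ?_, ?_⟩
        · have : sumLinear (fun i => ContinuousLinearMap.adjoint (L i))
              (diagLinear (fun i => ContinuousLinearMap.adjoint (K i)) (WithLp.toLp 2 p₀)) =
              ∑ i, ContinuousLinearMap.adjoint (L i) (w₀ i) := by
            simp [sumLinear, diagLinear, hpw]
          rw [this, hz₀]
          convert hu₀ using 1
          abel
        · ext i
          exact (hpw i).trans (hqw i).symm
        · ext i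
          exact hab i)
      hε hγ (x := x) (xt := xt) (jx := jx) (p := fun n => WithLp.toLp 2 (p n))
      (pt := fun n => WithLp.toLp 2 (pt n)) (jp := fun n => WithLp.toLp 2 fun i => jp i n)
      (q := fun n => WithLp.toLp 2 (q n)) (qt := fun n => WithLp.toLp 2 (qt n))
      (jq := fun n => WithLp.toLp 2 fun i => jq i n) (z := fun n => WithLp.toLp 2 (zz n))
      (zt := fun n => WithLp.toLp 2 (zt n)) (y := fun n => WithLp.toLp 2 (y n))
      (yt := fun n => WithLp.toLp 2 (yt n)) (v := fun n => WithLp.toLp 2 (v n))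
      (vt := fun n => WithLp.toLp 2 (vt n)) (u₁ := fun n => WithLp.toLp 2 (u1 n))
      (u₂ := fun n => WithLp.toLp 2 (u2 n))
      hjx hxt (fun n => isRes_piOp fun i => hjp i n) (Summable.norm_piLp hpt)
      (fun n => isRes_piOp fun i => hjq i n) (Summable.norm_piLp hqt)
      (Summable.norm_piLp hu1) (Summable.norm_piLp hu2) (Summable.norm_piLp hzt)
      (Summable.norm_piLp hyt) (Summable.norm_piLp hvt) hx (Summable.norm_piLp hp)
      (Summable.norm_piLp hq) (Summable.norm_piLp hz) (Summable.norm_piLp hy)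
      (Summable.norm_piLp hv)
  exact ⟨xb, pb, qb, yb, h1, h2, h3, fun i => congrArg (fun f => f i) h4, c1, c2,
    fun i => c3.piLp_apply i, fun i => c4.piLp_apply i, fun i => c5.piLp_apply i,
    fun i => c6.piLp_apply i, fun i => c7.piLp_apply i, fun i => c8.piLp_apply i⟩
end
end
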